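/- arXiv:2103.03952 — 2 statements merged into one kernel-verified Lean document; each statement's English description precedes it below -/
import Mathlib

section
/- For integers n ≥ 3 and m ≥ 1, the triangulation M_{n,m} of the 2-sphere 8-stars to M_{n,m−1}: there is a finite sequence of 8-starrings transforming M_{n,m} into a complex isomorphic to M_{n,m−1}. -/
open Finset
open scoped Classical

/-- An abstract simplicial complex on vertex type `V`: a downward-closed family of
nonempty finite subsets of `V`. -/
structure SComplex (V : Type*) where
  faces : Set (Finset V)
  not_empty_mem : ∅ ∉ faces
  down_closed : ∀ {s t : Finset V}, s ∈ faces → t ⊆ s → t.Nonempty → t ∈ faces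

namespace SComplex

variable {V W : Type*}

/-- The vertex set of a simplicial complex. -/
def vertexSet (K : SComplex V) : Set V := {v | {v} ∈ K.faces}

/-- The geometric realization of a simplicial complex, as the set of convex-combination
coordinate functions supported on a simplex. -/
def realization (K : SComplex V) : Set (V → ℝ) :=
  {x | ∃ σ ∈ K.faces, (∀ v, 0 ≤ x v) ∧ (∀ v, v ∉ σ → x v = 0) ∧ (∑ v ∈ σ, x v) = 1}

/-- The geometric realization as a topological space. -/
abbrev space (K : SComplex V) : Type _ := ↥(K.realization)

/-- `L` is a subcomplex of `K`. -/
def IsSubcomplex (L K : SComplex V) : Prop := L.faces ⊆ K.faces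

/-- A complex is `r`-conic (`r` an integer, possibly `-1`) if every subcomplex with at
most `r` vertices is contained in the closed star of some vertex. -/
def IsConic (K : SComplex V) (r : ℤ) : Prop :=
  ∀ L : SComplex V, L.IsSubcomplex K → L.vertexSet.Finite →
    (L.vertexSet.ncard : ℤ) ≤ r →
    ∃ v ∈ K.vertexSet, ∀ σ ∈ L.faces, insert v σ ∈ K.faces

/-- The link of a vertex `v` in `K`. -/
def vertexLink (K : SComplex V) (v : V) : Set (Finset V) :=
  {τ ∈ K.faces | v ∉ τ ∧ insert v τ ∈ K.faces}

/-- A nonempty complex is `r`-ample if for every set `U` of at most `r` vertices and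
every subcomplex `L` with vertices in `U`, some vertex `v` has a link whose simplices
contained in `U` are exactly those of `L`. -/
def IsAmple (K : SComplex V) (r : ℕ) : Prop :=
  K.faces.Nonempty ∧
  ∀ U : Finset V, ↑U ⊆ K.vertexSet → U.card ≤ r →
    ∀ L : SComplex V, L.IsSubcomplex K → L.vertexSet ⊆ ↑U →
      ∃ v ∈ K.vertexSet, {τ ∈ K.vertexLink v | ↑τ ⊆ (U : Set V)} = L.faces

end SComplex

/-- A topological space is `n`-connected if it is nonempty and every continuous map
from the `k`-sphere, `0 ≤ k ≤ n`, is null-homotopic. -/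
def NConnected (n : ℕ) (X : Type*) [TopologicalSpace X] : Prop :=
  Nonempty X ∧ ∀ k : ℕ, k ≤ n →
    ∀ f : C(Metric.sphere (0 : EuclideanSpace ℝ (Fin (k + 1))) 1, X),
      f.Nullhomotopic

namespace SComplex

variable {V W : Type*}

/-- The affine extension of a vertex assignment `φ : W → (V → ℝ)` to barycentric
coordinate functions. -/
noncomputable def affMap (φ : W → V → ℝ) (x : W → ℝ) : V → ℝ :=
  fun v => ∑ᶠ w, x w * φ w v

/-- The closed geometric simplex of `K` spanned by the vertices of `σ`. -/
def geomSimplex (K : SComplex V) (σ : Finset V) : Set (V → ℝ) :=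
  {x ∈ K.realization | ∀ v, v ∉ σ → x v = 0}

/-- `L` is a (geometric) subdivision of `K` via the vertex placement `φ`: the affine
extension of `φ` maps `|L|` bijectively onto `|K|` and maps each closed simplex of `L`
into a closed simplex of `K`. -/
def IsSubdivisionVia (L : SComplex W) (φ : W → V → ℝ) (K : SComplex V) : Prop :=
  Set.BijOn (affMap φ) L.realization K.realization ∧
  ∀ σ ∈ L.faces, ∃ τ ∈ K.faces, affMap φ '' L.geomSimplex σ ⊆ K.geomSimplex τ

/-- `f` realizes a simplicial isomorphism from `K` onto `L`. -/
def IsIsoMap (f : V → W) (K : SComplex V) (L : SComplex W) : Prop :=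
  Set.InjOn f K.vertexSet ∧
  (∀ σ ∈ K.faces, σ.image f ∈ L.faces) ∧
  (∀ τ ∈ L.faces, ∃ σ ∈ K.faces, σ.image f = τ)

/-- Two simplicial complexes are isomorphic. -/
def Iso (K : SComplex V) (L : SComplex W) : Prop :=
  ∃ f : V → W, IsIsoMap f K L

/-- Two simplicial complexes are PL homeomorphic if they admit simplicially isomorphic
subdivisions. -/
def PLHomeo (K : SComplex V) (L : SComplex W) : Prop :=
  ∃ (A B : Type) (K' : SComplex A) (L' : SComplex B)
    (φ : A → V → ℝ) (ψ : B → W → ℝ),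
      IsSubdivisionVia K' φ K ∧ IsSubdivisionVia L' ψ L ∧ Iso K' L'

end SComplex

/-- The standard `n`-simplex as a simplicial complex: all nonempty subsets of
`Fin (n+1)`. -/
def stdSimplexC (n : ℕ) : SComplex (Fin (n + 1)) where
  faces := {σ | σ.Nonempty}
  not_empty_mem := by simp [Set.mem_setOf_eq]
  down_closed := fun _ _ h => h

/-- The boundary of the standard simplex on `Fin j`: all nonempty proper subsets.
For `j = m + 2` this is the combinatorial `m`-sphere `∂Δ^{m+1}`; for `j = 1` it is the
empty complex (the `(-1)`-sphere). -/
def boundaryC (j : ℕ) : SComplex (Fin j) where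
  faces := {σ | σ.Nonempty ∧ σ ≠ Finset.univ}
  not_empty_mem := by
    rintro ⟨h, -⟩; exact Finset.not_nonempty_empty h
  down_closed := by
    rintro s t ⟨-, hs⟩ hts ht
    refine ⟨ht, fun h => hs ?_⟩
    subst h
    exact Finset.univ_subset_iff.mp hts

namespace SComplex

variable {V : Type*}

/-- A combinatorial `d`-ball: a complex PL homeomorphic to the standard `d`-simplex. -/
def IsCombBall (d : ℕ) (K : SComplex V) : Prop := K.PLHomeo (stdSimplexC d)

/-- A complex PL homeomorphic to `∂Δ^{j-1}`, i.e. a combinatorial `(j-2)`-sphere. -/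
def IsCombSphereAux (j : ℕ) (K : SComplex V) : Prop := K.PLHomeo (boundaryC j)

/-- The link of a simplex `σ` in `K`, as a simplicial complex. -/
def linkC (K : SComplex V) (σ : Finset V) : SComplex V where
  faces := {τ | τ ∈ K.faces ∧ (∀ v ∈ σ, v ∉ τ) ∧ τ ∪ σ ∈ K.faces}
  not_empty_mem := fun h => K.not_empty_mem h.1
  down_closed := by
    rintro s t ⟨hs, hdisj, huni⟩ hts ht
    refine ⟨K.down_closed hs hts ht, fun v hv hvt => hdisj v hv (hts hvt), ?_⟩
    refine K.down_closed huni (Finset.union_subset_union_left hts) ?_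
    exact ht.mono Finset.subset_union_left

/-- A combinatorial (PL) `n`-manifold: the link of every simplex `σ` is a combinatorial
sphere of dimension `n - dim σ - 1` (PL homeomorphic to the boundary of the standard
`(n - dim σ)`-simplex). -/
def IsCombManifold (n : ℕ) (M : SComplex V) : Prop :=
  M.faces.Nonempty ∧
  ∀ σ ∈ M.faces, (M.linkC σ).IsCombSphereAux (n + 2 - σ.card)

/-- `(D, bD)` is a triangulated `d`-disk: there is a homeomorphism from `|D|` to the
closed unit `d`-ball carrying `|bD|` exactly onto the boundary sphere. -/
def IsTriangulatedDisk (D bD : SComplex V) (d : ℕ) : Prop :=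
  bD.IsSubcomplex D ∧
  ∃ e : D.space ≃ₜ (Metric.closedBall (0 : EuclideanSpace ℝ (Fin d)) 1),
    ∀ x : D.space, (x : V → ℝ) ∈ bD.realization ↔
      ((e x : EuclideanSpace ℝ (Fin d)) ∈
        Metric.sphere (0 : EuclideanSpace ℝ (Fin d)) 1)

/-- The faces of the cone with apex `w` over the family of faces `F`. -/
def coneFaces (w : V) (F : Set (Finset V)) : Set (Finset V) :=
  F ∪ (insert w '' F) ∪ {{w}}

/-- `Mt` is obtained from `M` by starring the triangulated `d`-disk `D` (with boundary
`bD`) at the new vertex `w`: all simplices of `D` not in `bD` are removed and the cone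
`w ∂D` is attached. -/
def IsStarringAt (r : ℤ) (M Mt : SComplex V) (D bD : SComplex V) (d : ℕ) (w : V) :
    Prop :=
  D.IsSubcomplex M ∧
  D.vertexSet.Finite ∧ (D.vertexSet.ncard : ℤ) ≤ r ∧
  IsTriangulatedDisk D bD d ∧
  (∀ σ ∈ M.faces, ∀ τ ∈ D.faces, τ ∉ bD.faces → τ ⊆ σ → σ ∈ D.faces) ∧
  w ∉ M.vertexSet ∧
  Mt.faces = (M.faces \ {τ | τ ∈ D.faces ∧ τ ∉ bD.faces}) ∪ coneFaces w bD.faces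

/-- `Mt` is obtained from `M` by an `r`-starring. -/
def IsStarring (r : ℤ) (M Mt : SComplex V) : Prop :=
  ∃ (D bD : SComplex V) (d : ℕ) (w : V), IsStarringAt r M Mt D bD d w

/-- `M` `r`-stars to `L`: `L` is obtained from `M` by a finite sequence of
`r`-starrings. -/
def StarsTo (r : ℤ) : SComplex V → SComplex V → Prop :=
  Relation.ReflTransGen (IsStarring r)

end SComplex

/-- The triangles of the triangulation `M_{n,m}` of `S²`: an `n × m` grid of squares on
the cylinder `S¹ × I`, each divided into two triangles, capped by two cones with apexes
`inl false` (bottom) and `inl true` (top). -/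
def MnmTri (n m : ℕ) : Set (Finset (Bool ⊕ ZMod n × Fin (m + 1))) :=
  {T | (∃ (i : ZMod n) (j : ℕ) (hj : j < m),
          T = {Sum.inr (i, ⟨j, by omega⟩), Sum.inr (i + 1, ⟨j, by omega⟩),
               Sum.inr (i + 1, ⟨j + 1, by omega⟩)} ∨
          T = {Sum.inr (i, ⟨j, by omega⟩), Sum.inr (i + 1, ⟨j + 1, by omega⟩),
               Sum.inr (i, ⟨j + 1, by omega⟩)}) ∨
       (∃ i : ZMod n,
          T = {Sum.inl false, Sum.inr (i, ⟨0, by omega⟩),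
               Sum.inr (i + 1, ⟨0, by omega⟩)}) ∨
       (∃ i : ZMod n,
          T = {Sum.inl true, Sum.inr (i, ⟨m, by omega⟩),
               Sum.inr (i + 1, ⟨m, by omega⟩)})}

/-- The triangulation `M_{n,m}` of the `2`-sphere: `n × m` grid squares on a cylinder,
each divided in two triangles, capped by two cones.  For `m = 0` this is the simplicial
suspension of the cycle on `n` vertices. -/
def Mnm (n m : ℕ) : SComplex (Bool ⊕ ZMod n × Fin (m + 1)) where
  faces := {σ | σ.Nonempty ∧ ∃ T ∈ MnmTri n m, σ ⊆ T}
  not_empty_mem := by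
    rintro ⟨h, -⟩; exact Finset.not_nonempty_empty h
  down_closed := by
    rintro s t ⟨-, T, hT, hsT⟩ hts ht
    exact ⟨ht, T, hT, hts.trans hsT⟩

namespace SComplex

/-- The simplicial complex whose faces are the nonempty subsets of members of `S`. -/
def generated {V : Type*} (S : Set (Finset V)) : SComplex V where
  faces := {σ | σ.Nonempty ∧ ∃ t ∈ S, σ ⊆ t}
  not_empty_mem := by
    rintro ⟨h, -⟩; exact Finset.not_nonempty_empty h
  down_closed := by
    rintro s t ⟨-, T, hT, hsT⟩ hts ht
    exact ⟨ht, T, hT, hts.trans hsT⟩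

theorem mem_realization_generated {V : Type*} {S : Set (Finset V)} {x : V → ℝ} :
    x ∈ (generated S).realization ↔
      ∃ t ∈ S, (∀ v, 0 ≤ x v) ∧ (∀ v, v ∉ t → x v = 0) ∧ ∑ v ∈ t, x v = 1 := by
  constructor
  · rintro ⟨σ, ⟨-, t, ht, hσt⟩, h0, hσ, hs⟩
    refine ⟨t, ht, h0, fun v hv => hσ v fun h => hv (hσt h), ?_⟩
    rw [← hs]
    exact (Finset.sum_subset hσt fun v _ hv => hσ v hv).symm
  · rintro ⟨t, ht, h0, hz, hs⟩
    refine ⟨t, ⟨?_, t, ht, subset_rfl⟩, h0, hz, hs⟩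
    rw [Finset.nonempty_iff_ne_empty]
    rintro rfl
    simp at hs

theorem mem_realization_generated_fintype {V : Type*} [Fintype V] {S : Set (Finset V)}
    {x : V → ℝ} :
    x ∈ (generated S).realization ↔
      (∀ v, 0 ≤ x v) ∧ ∑ v, x v = 1 ∧ ∃ t ∈ S, ∀ v, v ∉ t → x v = 0 := by
  rw [mem_realization_generated]
  constructor
  · rintro ⟨t, ht, h0, hz, hs⟩
    refine ⟨h0, ?_, t, ht, hz⟩
    rw [← hs]
    exact (Finset.sum_subset (Finset.subset_univ t) fun v _ hv => hz v hv).symm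
  · rintro ⟨h0, hs, t, ht, hz⟩
    refine ⟨t, ht, h0, hz, ?_⟩
    rw [← hs]
    exact Finset.sum_subset (Finset.subset_univ t) fun v _ hv => hz v hv

/-- The realization of `generated S` is a closed disk whose boundary circle is the
realization of `generated B`. -/
def DiskPair {V : Type*} (S B : Set (Finset V)) : Prop :=
  ∃ e : (generated S).space ≃ₜ (Metric.closedBall (0 : EuclideanSpace ℝ (Fin 2)) 1),
    ∀ x : (generated S).space, (x : V → ℝ) ∈ (generated B).realization ↔
      ((e x : EuclideanSpace ℝ (Fin 2)) ∈ Metric.sphere (0 : EuclideanSpace ℝ (Fin 2)) 1)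

/-- Mutually inverse continuous maps between subsets induce a homeomorphism. -/
def homeomorphOfMapsTo {X Y : Type*} [TopologicalSpace X] [TopologicalSpace Y]
    {s : Set X} {t : Set Y} (f : X → Y) (g : Y → X) (hf : Continuous f) (hg : Continuous g)
    (hst : Set.MapsTo f s t) (hts : Set.MapsTo g t s)
    (hgf : ∀ x ∈ s, g (f x) = x) (hfg : ∀ y ∈ t, f (g y) = y) : s ≃ₜ t where
  toFun x := ⟨f x, hst x.2⟩
  invFun y := ⟨g y, hts y.2⟩
  left_inv x := Subtype.ext (hgf x x.2)
  right_inv y := Subtype.ext (hfg y y.2)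
  continuous_toFun := (hf.comp continuous_subtype_val).subtype_mk _
  continuous_invFun := (hg.comp continuous_subtype_val).subtype_mk _

theorem DiskPair.transport {V W : Type*} {S B : Set (Finset V)} {S' B' : Set (Finset W)}
    (h : DiskPair S B) (f : (W → ℝ) → (V → ℝ)) (g : (V → ℝ) → (W → ℝ))
    (hf : Continuous f) (hg : Continuous g)
    (hfS : Set.MapsTo f (generated S').realization (generated S).realization)
    (hgS : Set.MapsTo g (generated S).realization (generated S').realization)
    (hgf : ∀ x ∈ (generated S').realization, g (f x) = x)
    (hfg : ∀ x ∈ (generated S).realization, f (g x) = x)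
    (hfB : Set.MapsTo f (generated B').realization (generated B).realization)
    (hgB : Set.MapsTo g (generated B).realization (generated B').realization) :
    DiskPair S' B' := by
  obtain ⟨e, he⟩ := h
  refine ⟨(homeomorphOfMapsTo f g hf hg hfS hgS hgf hfg).trans e, fun x => ?_⟩
  rw [Homeomorph.trans_apply, ← he]
  refine ⟨fun hx => hfB hx, fun hx => ?_⟩
  rw [← hgf x x.2]
  exact hgB hx

/-- Enlarging or shrinking generators without changing the faces preserves disks. -/
theorem generated_congr {V : Type*} {S S' : Set (Finset V)}
    (h : ∀ s ∈ S, ∃ t ∈ S', s ⊆ t) (h' : ∀ s ∈ S', ∃ t ∈ S, s ⊆ t) :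
    generated S = generated S' := by
  have : (generated S).faces = (generated S').faces := by
    ext σ
    constructor
    · rintro ⟨h0, s, hs, hσ⟩
      obtain ⟨t, ht, hst⟩ := h s hs
      exact ⟨h0, t, ht, hσ.trans hst⟩
    · rintro ⟨h0, s, hs, hσ⟩
      obtain ⟨t, ht, hst⟩ := h' s hs
      exact ⟨h0, t, ht, hσ.trans hst⟩
  cases hS : generated S
  cases hS' : generated S'
  simp_all

theorem DiskPair.congr {V : Type*} {S S' B B' : Set (Finset V)} (hd : DiskPair S B)
    (h : generated S = generated S') (hB : generated B = generated B') : DiskPair S' B' := by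
  unfold DiskPair at *
  rwa [← h, ← hB]

theorem inf'_eq_zero {V : Type*} {σ : Finset V} (hσ : σ.Nonempty) {z : V → ℝ} (h0 : ∀ v, 0 ≤ z v)
    {v : V} (hv : v ∈ σ) (hz : z v = 0) : σ.inf' hσ z = 0 :=
  le_antisymm (hz ▸ inf'_le z hv) (le_inf' hσ z fun u _ => h0 u)

section Subdivision

variable {V : Type*} [DecidableEq V]

/-- Generators of the stellar subdivision at the face `σ` with new vertex `y`. -/
def subdivide (σ : Finset V) (y : V) (S : Set (Finset V)) : Set (Finset V) :=
  {s | (s ∈ S ∧ ¬ σ ⊆ s) ∨ ∃ t ∈ S, σ ⊆ t ∧ ∃ v ∈ σ, insert y (t.erase v) = s}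

/-- The map spreading the weight of `y` evenly over `σ`. -/
noncomputable def spread (σ : Finset V) (y : V) (x : V → ℝ) : V → ℝ := fun v =>
  if v = y then 0 else x v + if v ∈ σ then x y / σ.card else 0

/-- The map collecting the common weight of the vertices of `σ` at `y`. -/
noncomputable def collect (σ : Finset V) (hσ : σ.Nonempty) (y : V) (z : V → ℝ) : V → ℝ :=
  fun v => if v = y then σ.card * σ.inf' hσ z else z v - if v ∈ σ then σ.inf' hσ z else 0

theorem continuous_spread (σ : Finset V) (y : V) : Continuous (spread σ y) := by
  refine continuous_pi fun v => ?_
  unfold spread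
  split_ifs <;> fun_prop

theorem continuous_collect (σ : Finset V) (hσ : σ.Nonempty) (y : V) :
    Continuous (collect σ hσ y) := by
  have h : Continuous fun z : V → ℝ => σ.inf' hσ z :=
    Continuous.finset_inf'_apply hσ fun i _ => continuous_apply i
  refine continuous_pi fun v => ?_
  unfold collect
  split_ifs <;> fun_prop

variable [Fintype V]

theorem sum_spread {σ : Finset V} (hσ : σ.Nonempty) {y : V} (hy : y ∉ σ) (x : V → ℝ) :
    ∑ v, spread σ y x v = ∑ v, x v := by
  have hc : (σ.card : ℝ) ≠ 0 := by exact_mod_cast hσ.card_pos.ne'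
  have h : ∀ v, spread σ y x v =
      x v + ((if v ∈ σ then x y / σ.card else 0) - if v = y then x y else 0) := by
    intro v
    unfold spread
    split_ifs with h1 h2 <;> simp_all
  simp only [h, sum_add_distrib, sum_sub_distrib, sum_ite_eq', sum_ite_mem, univ_inter,
    sum_const, nsmul_eq_mul, mem_univ, if_true]
  field_simp
  ring

theorem sum_collect {σ : Finset V} (hσ : σ.Nonempty) {y : V} (hy : y ∉ σ) {z : V → ℝ}
    (hz : z y = 0) : ∑ v, collect σ hσ y z v = ∑ v, z v := by
  have h : ∀ v, collect σ hσ y z v = z v +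
      ((if v = y then σ.card * σ.inf' hσ z else 0) - if v ∈ σ then σ.inf' hσ z else 0) := by
    intro v
    unfold collect
    split_ifs with h1 h2 <;> simp_all [sub_eq_add_neg]
  simp only [h, sum_add_distrib, sum_sub_distrib, sum_ite_eq', sum_ite_mem, univ_inter,
    sum_const, nsmul_eq_mul, mem_univ, if_true]
  ring

theorem mapsTo_spread {σ : Finset V} (hσ : σ.Nonempty) {y : V} (hy : y ∉ σ)
    (S : Set (Finset V)) (hS : ∀ s ∈ S, y ∉ s) :
    Set.MapsTo (spread σ y) (generated (subdivide σ y S)).realization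
      (generated S).realization := by
  intro x hx
  rw [mem_realization_generated_fintype] at hx ⊢
  obtain ⟨h0, h1, s, hs, hz⟩ := hx
  refine ⟨fun v => ?_, by rw [sum_spread hσ hy, h1], ?_⟩
  · have := h0 v
    have := div_nonneg (h0 y) (Nat.cast_nonneg (α := ℝ) σ.card)
    unfold spread
    split_ifs <;> linarith
  · rcases hs with ⟨hs, hσs⟩ | ⟨t, ht, hσt, v, hv, rfl⟩
    · refine ⟨s, hs, fun v hv => ?_⟩
      have := hz y (hS s hs)
      unfold spread
      simp [this, hz v hv]
    · refine ⟨t, ht, fun u hu => ?_⟩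
      have huσ : u ∉ σ := fun h => hu (hσt h)
      unfold spread
      split_ifs with h
      · rfl
      · simp [hz u (by simp [h, hu])]

theorem mapsTo_collect {σ : Finset V} (hσ : σ.Nonempty) {y : V} (hy : y ∉ σ)
    (S : Set (Finset V)) (hS : ∀ s ∈ S, y ∉ s) :
    Set.MapsTo (collect σ hσ y) (generated S).realization
      (generated (subdivide σ y S)).realization := by
  intro z hz
  rw [mem_realization_generated_fintype] at hz ⊢
  obtain ⟨h0, h1, s, hs, hz⟩ := hz
  have hm0 : 0 ≤ σ.inf' hσ z := le_inf' hσ z fun u _ => h0 u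
  refine ⟨fun v => ?_, by rw [sum_collect hσ hy (hz y (hS s hs)), h1], ?_⟩
  · unfold collect
    split_ifs with h h'
    · positivity
    · exact sub_nonneg.2 (inf'_le z h')
    · simpa using h0 v
  · by_cases hσs : σ ⊆ s
    · obtain ⟨v, hv, hvm⟩ := exists_mem_eq_inf' hσ z
      refine ⟨insert y (s.erase v), Or.inr ⟨s, hs, hσs, v, hv, rfl⟩,
        fun u hu => ?_⟩
      simp only [mem_insert, mem_erase, not_or, not_and] at hu
      unfold collect
      rw [if_neg hu.1]
      by_cases huv : u = v
      · subst huv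
        simp [hv, hvm]
      · rw [if_neg fun h => hu.2 huv (hσs h), hz u (hu.2 huv), sub_zero]
    · obtain ⟨v, hv, hvs⟩ := not_subset.1 hσs
      have hm := inf'_eq_zero hσ h0 hv (hz v hvs)
      refine ⟨s, Or.inl ⟨hs, hσs⟩, fun u hu => ?_⟩
      unfold collect
      simp [hm, hz u hu]

theorem collect_spread {σ : Finset V} (hσ : σ.Nonempty) {y : V} (hy : y ∉ σ)
    (S : Set (Finset V)) (hS : ∀ s ∈ S, y ∉ s) {x : V → ℝ}
    (hx : x ∈ (generated (subdivide σ y S)).realization) :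
    collect σ hσ y (spread σ y x) = x := by
  rw [mem_realization_generated_fintype] at hx
  obtain ⟨h0, h1, s, hs, hz⟩ := hx
  have hc : (σ.card : ℝ) ≠ 0 := by exact_mod_cast hσ.card_pos.ne'
  have hne : ∀ v ∈ σ, v ≠ y := fun v hv h => hy (h ▸ hv)
  obtain ⟨v, hv, hvs⟩ : ∃ v ∈ σ, v ∉ s := by
    rcases hs with ⟨-, h⟩ | ⟨t, -, -, v, hv, rfl⟩
    · exact not_subset.1 h
    · exact ⟨v, hv, by simp [hne v hv]⟩
  have hm : σ.inf' hσ (spread σ y x) = x y / σ.card := by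
    apply le_antisymm
    · refine (inf'_le _ hv).trans_eq ?_
      simp [spread, hne v hv, hv, hz v hvs]
    · refine le_inf' hσ _ fun u hu => ?_
      simp [spread, hne u hu, hu, h0 u]
  funext u
  unfold collect
  rw [hm]
  split_ifs with h h'
  · subst h
    field_simp
  · simp [spread, h, h']
  · simp [spread, h, h']

theorem spread_collect {σ : Finset V} (hσ : σ.Nonempty) {y : V}
    (S : Set (Finset V)) (hS : ∀ s ∈ S, y ∉ s) {z : V → ℝ}
    (hz : z ∈ (generated S).realization) :
    spread σ y (collect σ hσ y z) = z := by
  rw [mem_realization_generated_fintype] at hz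
  obtain ⟨-, -, s, hs, hz⟩ := hz
  have hc : (σ.card : ℝ) ≠ 0 := by exact_mod_cast hσ.card_pos.ne'
  funext u
  unfold spread
  split_ifs with h h'
  · rw [h, hz y (hS s hs)]
  · simp [collect, h, h', mul_div_cancel_left₀ _ hc]
  · simp [collect, h, h']

theorem diskPair_subdivide_iff {σ : Finset V} (hσ : σ.Nonempty) {y : V} (hy : y ∉ σ)
    {S B : Set (Finset V)} (hS : ∀ s ∈ S, y ∉ s) (hB : ∀ s ∈ B, y ∉ s) :
    DiskPair (subdivide σ y S) (subdivide σ y B) ↔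
      DiskPair S B :=
  ⟨fun h => h.transport (collect σ hσ y) (spread σ y) (continuous_collect σ hσ y)
      (continuous_spread σ y) (mapsTo_collect hσ hy S hS) (mapsTo_spread hσ hy S hS)
      (fun _ => spread_collect hσ S hS) (fun _ => collect_spread hσ hy S hS)
      (mapsTo_collect hσ hy B hB) (mapsTo_spread hσ hy B hB),
    fun h => h.transport (spread σ y) (collect σ hσ y) (continuous_spread σ y)
      (continuous_collect σ hσ y) (mapsTo_spread hσ hy S hS) (mapsTo_collect hσ hy S hS)
      (fun _ => collect_spread hσ hy S hS) (fun _ => spread_collect hσ S hS)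
      (mapsTo_spread hσ hy B hB) (mapsTo_collect hσ hy B hB)⟩

end Subdivision

theorem DiskPair.image {V W : Type*} [Fintype W] {S B : Set (Finset W)} (h : DiskPair S B)
    (ι : W → V) (U : Set W) (hι : Set.InjOn ι U) (hS : ∀ s ∈ S, (s : Set W) ⊆ U)
    (hB : ∀ s ∈ B, (s : Set W) ⊆ U) :
    DiskPair (Finset.image ι '' S) (Finset.image ι '' B) := by
  have pull : ∀ R : Set (Finset W), (∀ s ∈ R, (s : Set W) ⊆ U) →
      Set.MapsTo (fun (z : V → ℝ) i => if i ∈ U then z (ι i) else 0)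
        (generated (Finset.image ι '' R)).realization (generated R).realization := by
    intro R hR z hz
    rw [mem_realization_generated] at hz ⊢
    obtain ⟨_, ⟨s, hs, rfl⟩, h0, hz, h1⟩ := hz
    refine ⟨s, hs, fun i => ?_, fun i hi => ?_, ?_⟩
    · dsimp only
      split_ifs
      exacts [h0 _, le_rfl]
    · dsimp only
      split_ifs with hU
      · refine hz _ fun hm => hi ?_
        obtain ⟨j, hj, hji⟩ := mem_image.1 hm
        rwa [← hι (hR s hs hj) hU hji]
      · rfl
    · rw [← h1, sum_image fun i hi j hj => hι (hR s hs hi) (hR s hs hj)]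
      exact sum_congr rfl fun i hi => if_pos (hR s hs hi)
  have push : ∀ R : Set (Finset W),
      Set.MapsTo (fun (x : W → ℝ) v => ∑ i, if ι i = v then x i else 0)
        (generated R).realization (generated (Finset.image ι '' R)).realization := by
    intro R x hx
    rw [mem_realization_generated] at hx ⊢
    obtain ⟨s, hs, h0, hz, h1⟩ := hx
    refine ⟨_, ⟨s, hs, rfl⟩, fun v => sum_nonneg fun i _ => ?_,
      fun v hv => sum_eq_zero fun i _ => ?_, ?_⟩
    · split_ifs
      exacts [h0 _, le_rfl]
    · split_ifs with hi
      · exact hz i fun his => hv (mem_image.2 ⟨i, his, hi⟩)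
      · rfl
    · rw [sum_comm, ← h1]
      rw [← Finset.sum_subset (subset_univ s)]
      · refine sum_congr rfl fun i hi => ?_
        rw [sum_ite_eq, if_pos (mem_image_of_mem ι hi)]
      · intro i _ hi
        simp [hz i hi]
  refine h.transport _ _ ?_ ?_ (pull S hS) (push S) ?_ ?_ (pull B hB) (push B)
  · refine continuous_pi fun i => ?_
    split_ifs <;> fun_prop
  · refine continuous_pi fun v => continuous_finsetSum _ fun i _ => ?_
    split_ifs <;> fun_prop
  · intro z hz
    rw [mem_realization_generated] at hz
    obtain ⟨_, ⟨s, hs, rfl⟩, h0, hz, h1⟩ := hz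
    funext v
    by_cases hv : ∃ i ∈ U, ι i = v
    · obtain ⟨i, hi, rfl⟩ := hv
      dsimp only
      rw [sum_eq_single i]
      · rw [if_pos rfl, if_pos hi]
      · intro j _ hj
        split_ifs with hjv hjU
        · exact absurd (hι hjU hi hjv) hj
        · rfl
        · rfl
      · simp
    · rw [hz v fun hm => hv ?_]
      · refine sum_eq_zero fun i _ => ?_
        dsimp only
        split_ifs with hiv hiU
        · exact absurd ⟨i, hiU, hiv⟩ hv
        · rfl
        · rfl
      · obtain ⟨j, hj, hji⟩ := mem_image.1 hm
        exact ⟨j, hS s hs hj, hji⟩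
  · intro x hx
    rw [mem_realization_generated] at hx
    obtain ⟨s, hs, h0, hz, h1⟩ := hx
    funext i
    dsimp only
    split_ifs with hi
    · rw [sum_eq_single i]
      · rw [if_pos rfl]
      · intro j _ hj
        split_ifs with h2
        · exact hz j fun hjs => hj (hι (hS s hs hjs) hi h2)
        · rfl
      · simp
    · exact (hz i fun his => hi (hS s hs his)).symm

/-- The coordinate triangle in the plane. -/
def planeTriangle : Set (EuclideanSpace ℝ (Fin 2)) := {p | 0 ≤ p 0 ∧ 0 ≤ p 1 ∧ p 0 + p 1 ≤ 1}

theorem isClosed_planeTriangle : IsClosed planeTriangle := by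
  have h0 : IsClosed {p : EuclideanSpace ℝ (Fin 2) | 0 ≤ p 0} :=
    isClosed_le (by fun_prop) (by fun_prop)
  have h1 : IsClosed {p : EuclideanSpace ℝ (Fin 2) | 0 ≤ p 1} :=
    isClosed_le (by fun_prop) (by fun_prop)
  have h2 : IsClosed {p : EuclideanSpace ℝ (Fin 2) | p 0 + p 1 ≤ 1} :=
    isClosed_le (by fun_prop) (by fun_prop)
  exact h0.inter (h1.inter h2)

theorem convex_planeTriangle : Convex ℝ planeTriangle := by
  rintro p ⟨h1, h2, h3⟩ q ⟨g1, g2, g3⟩ a b ha hb hab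
  simp only [planeTriangle, Set.mem_ofPred_eq, PiLp.add_apply, PiLp.smul_apply, smul_eq_mul]
  refine ⟨by positivity, by positivity, ?_⟩
  nlinarith

theorem isBounded_planeTriangle : Bornology.IsBounded planeTriangle := by
  refine (Metric.isBounded_closedBall (x := (0 : EuclideanSpace ℝ (Fin 2))) (r := 1)).subset ?_
  rintro p ⟨h1, h2, h3⟩
  rw [mem_closedBall_zero_iff, EuclideanSpace.norm_eq, Real.sqrt_le_left (by norm_num), one_pow]
  simp only [Fin.sum_univ_two, Real.norm_eq_abs, sq_abs]
  nlinarith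

theorem interior_planeTriangle :
    interior planeTriangle = {p | 0 < p 0 ∧ 0 < p 1 ∧ p 0 + p 1 < 1} := by
  apply subset_antisymm
  · intro p hp
    have key : ∀ u : EuclideanSpace ℝ (Fin 2), ∃ ε > 0, p + (ε : ℝ) • u ∈ planeTriangle := by
      intro u
      have hc : Filter.Tendsto (fun ε : ℝ => p + ε • u) (nhdsWithin 0 (Set.Ioi 0)) (nhds p) := by
        have : Continuous fun ε : ℝ => p + ε • u := by fun_prop
        simpa using (this.tendsto 0).mono_left nhdsWithin_le_nhds
      obtain ⟨ε, h1, h2⟩ :=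
        ((hc.eventually (mem_interior_iff_mem_nhds.1 hp)).and self_mem_nhdsWithin).exists
      exact ⟨ε, h2, h1⟩
    obtain ⟨ε, hε, h1, h2, -⟩ := key !₂[-1, -1]
    obtain ⟨δ, hδ, -, -, h3⟩ := key !₂[1, 1]
    simp at h1 h2 h3
    exact ⟨by linarith, by linarith, by linarith⟩
  · refine interior_maximal (fun p hp => ⟨hp.1.le, hp.2.1.le, hp.2.2.le⟩) ?_
    have h0 : IsOpen {p : EuclideanSpace ℝ (Fin 2) | 0 < p 0} :=
      isOpen_lt (by fun_prop) (by fun_prop)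
    have h1 : IsOpen {p : EuclideanSpace ℝ (Fin 2) | 0 < p 1} :=
      isOpen_lt (by fun_prop) (by fun_prop)
    have h2 : IsOpen {p : EuclideanSpace ℝ (Fin 2) | p 0 + p 1 < 1} :=
      isOpen_lt (by fun_prop) (by fun_prop)
    exact h0.inter (h1.inter h2)

theorem diskPair_triangle :
    DiskPair ({{0, 1, 2}} : Set (Finset (Fin 9)))
      ({{0, 1}, {1, 2}, {0, 2}} : Set (Finset (Fin 9))) := by
  obtain ⟨h, -, hcl, hfr⟩ := exists_homeomorph_image_interior_closure_frontier_eq_unitBall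
    convex_planeTriangle (by
      rw [interior_planeTriangle]
      exact ⟨!₂[1/4, 1/4], by norm_num⟩) isBounded_planeTriangle
  rw [isClosed_planeTriangle.closure_eq] at hcl
  have hS : ∀ x : Fin 9 → ℝ, x ∈ (generated
      ({{0, 1, 2}} : Set (Finset (Fin 9)))).realization ↔
      (0 ≤ x 0 ∧ 0 ≤ x 1 ∧ 0 ≤ x 2) ∧ x 0 + x 1 + x 2 = 1 ∧ 
        ∀ i : Fin 9, i ∉ ({0, 1, 2} : Finset (Fin 9)) → x i = 0 := by
    intro x
    rw [mem_realization_generated]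
    simp only [Set.mem_singleton_iff, exists_eq_left]
    rw [show ∑ v ∈ ({0, 1, 2} : Finset (Fin 9)), x v = x 0 + x 1 + x 2 by
      rw [sum_insert (by decide), sum_insert (by decide), sum_singleton, add_assoc]]
    refine ⟨fun ⟨h0, h1, h2⟩ => ⟨⟨h0 0, h0 1, h0 2⟩, h2, h1⟩,
      fun ⟨⟨h0, h0', h0''⟩, h1, h2⟩ => ⟨fun v => ?_, h2, h1⟩⟩
    by_cases hv : v ∈ ({0, 1, 2} : Finset (Fin 9))
    · simp only [mem_insert, mem_singleton] at hv
      rcases hv with rfl | rfl | rfl <;> assumption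
    · exact (h2 v hv).ge
  let f : (Fin 9 → ℝ) → EuclideanSpace ℝ (Fin 2) := fun x => !₂[x 0, x 1]
  let g : EuclideanSpace ℝ (Fin 2) → (Fin 9 → ℝ) := fun p i =>
    if i = 0 then p 0 else if i = 1 then p 1 else if i = 2 then 1 - p 0 - p 1 else 0
  have hf : Continuous f := by
    refine (PiLp.continuous_toLp 2 _).comp (continuous_pi fun i => ?_)
    fin_cases i <;> simp <;> fun_prop
  have hg : Continuous g := by
    refine continuous_pi fun i => ?_
    simp only [g]
    split_ifs <;> fun_prop
  have hfS : Set.MapsTo f (generated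
      ({{0, 1, 2}} : Set (Finset (Fin 9)))).realization
      planeTriangle := by
    intro x hx
    obtain ⟨⟨h0, h1, h2⟩, h3, h4⟩ := (hS x).1 hx
    simp only [f, planeTriangle, Set.mem_ofPred_eq]
    simp
    exact ⟨h0, h1, by linarith⟩
  have hgS : Set.MapsTo g planeTriangle (generated
      ({{0, 1, 2}} : Set (Finset (Fin 9)))).realization := by
    rintro p ⟨h0, h1, h2⟩
    refine (hS _).2 ⟨?_, ?_, fun i hi => ?_⟩
    · simp [g]
      exact ⟨h0, h1, by linarith⟩
    · simp [g]
    · simp at hi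
      simp [g, hi]
  have hgf : ∀ x ∈ (generated
      ({{0, 1, 2}} : Set (Finset (Fin 9)))).realization,
      g (f x) = x := by
    intro x hx
    obtain ⟨⟨h0, h1, h2⟩, h3, h4⟩ := (hS x).1 hx
    funext i
    simp only [f, g]
    split_ifs with hi0 hi1 hi2
    · simp [hi0]
    · simp [hi1]
    · simp [hi2]
      linarith
    · exact (h4 i (by simp [hi0, hi1, hi2])).symm
  have hfg : ∀ p ∈ planeTriangle, f (g p) = p := by
    intro p _
    ext i
    fin_cases i <;> simp [f, g]
  have hball : Set.MapsTo h planeTriangle (Metric.closedBall 0 1) := fun p hp =>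
    hcl ▸ Set.mem_image_of_mem h hp
  have hball' : Set.MapsTo h.symm (Metric.closedBall 0 1) planeTriangle := by
    intro q hq
    rw [← hcl] at hq
    obtain ⟨p, hp, rfl⟩ := hq
    simpa using hp
  refine ⟨(homeomorphOfMapsTo f g hf hg hfS hgS hgf hfg).trans
    (homeomorphOfMapsTo h h.symm h.continuous h.symm.continuous hball hball'
      (fun _ _ => h.symm_apply_apply _) fun _ _ => h.apply_symm_apply _), ?_⟩
  rintro ⟨x, hx⟩
  change _ ↔ h (f x) ∈ _
  rw [← hfr, h.injective.mem_set_image, frontier, isClosed_planeTriangle.closure_eq,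
    interior_planeTriangle, Set.mem_sdiff]
  obtain ⟨⟨h0, h1, h2⟩, h3, h4⟩ := (hS x).1 hx
  have h5 : (f x ∈ planeTriangle) := hfS hx
  simp only [h5, true_and]
  have h6 : f x ∈ {p : EuclideanSpace ℝ (Fin 2) | 0 < p 0 ∧ 0 < p 1 ∧ p 0 + p 1 < 1} ↔
      0 < x 0 ∧ 0 < x 1 ∧ x 0 + x 1 < 1 := by simp [f]
  rw [h6, mem_realization_generated_fintype]
  constructor
  · rintro ⟨-, -, t, ht, hz⟩ ⟨g0, g1, g2⟩
    simp at ht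
    rcases ht with rfl | rfl | rfl
    · have := hz 2 (by decide)
      linarith
    · have := hz 0 (by decide)
      linarith
    · have := hz 1 (by decide)
      linarith
  · intro hn
    have hx' := mem_realization_generated_fintype.1 hx
    refine ⟨hx'.1, hx'.2.1, ?_⟩
    have h7 : ∃ j ∈ ({0, 1, 2} : Finset (Fin 9)), x j = 0 := by
      by_contra! h8
      have g0 := lt_of_le_of_ne h0 (h8 0 (by decide)).symm
      have g1 := lt_of_le_of_ne h1 (h8 1 (by decide)).symm
      have g2 := lt_of_le_of_ne h2 (h8 2 (by decide)).symm
      exact hn ⟨g0, g1, by linarith⟩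
    obtain ⟨j, hj, hj0⟩ := h7
    refine ⟨({0, 1, 2} : Finset (Fin 9)).erase j, ?_, fun v hv => ?_⟩
    · have key : ∀ j ∈ ({0, 1, 2} : Finset (Fin 9)), ({0, 1, 2} : Finset (Fin 9)).erase j ∈
          ({{0, 1}, {1, 2}, {0, 2}} : Finset (Finset (Fin 9))) := by decide
      simpa using key j hj
    · by_cases hvj : v = j
      · rw [hvj, hj0]
      · exact h4 v fun hv' => hv (mem_erase.2 ⟨hvj, hv'⟩)

/-- The set of vertices in `Fin 9` encoded by the binary digits of `k`. -/
def face (k : ℕ) : Finset (Fin 9) := univ.filter fun i => k.testBit i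

/-- The family of faces encoded by a list of numbers. -/
def faceSet (l : List ℕ) : Set (Finset (Fin 9)) := {s | ∃ k ∈ l, face k = s}

theorem mem_face {k : ℕ} {i : Fin 9} : i ∈ face k ↔ k.testBit i = true := by simp [face]

theorem exists_face_eq (s : Finset (Fin 9)) : ∃ k < 512, face k = s := by
  refine ⟨Nat.ofBits fun i => decide (i ∈ s), Nat.ofBits_lt_two_pow _, ?_⟩
  ext i
  rw [mem_face, Nat.testBit_ofBits_lt _ _ i.2]
  simp

/-- Inclusion of encoded faces. -/
def faceSubset (k l : ℕ) : Bool := (k &&& l) % 512 == k % 512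

theorem faceSubset_iff {k l : ℕ} : faceSubset k l = true ↔ face k ⊆ face l := by
  rw [faceSubset, beq_iff_eq]
  constructor
  · intro h i hi
    rw [mem_face] at hi ⊢
    have h1 : ((k &&& l) % 2 ^ 9).testBit i = (k % 2 ^ 9).testBit i :=
      congrArg (fun a => a.testBit i) h
    rw [Nat.testBit_mod_two_pow, Nat.testBit_mod_two_pow, Nat.testBit_and, hi] at h1
    simpa [i.2] using h1
  · intro h
    apply Nat.eq_of_testBit_eq
    intro i
    rw [show 512 = 2 ^ 9 from rfl, Nat.testBit_mod_two_pow, Nat.testBit_mod_two_pow,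
      Nat.testBit_and]
    by_cases hi : i < 9
    · have h1 := @h ⟨i, hi⟩
      rw [mem_face, mem_face] at h1
      simp only [hi, decide_true, Bool.true_and]
      cases hk : k.testBit i
      · simp
      · simp [h1 hk]
    · simp [hi]

theorem insert_erase_face {k : ℕ} {v y : Fin 9} (hv : v ∈ face k) :
    insert y ((face k).erase v) = face ((k ^^^ 2 ^ (v : ℕ)) ||| 2 ^ (y : ℕ)) := by
  ext i
  rw [mem_face] at hv
  simp only [mem_insert, mem_erase, mem_face, Nat.testBit_or, Nat.testBit_xor,
    Nat.testBit_two_pow, Bool.or_eq_true, decide_eq_true_eq, ← Fin.ext_iff]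
  by_cases hvi : i = v
  · subst hvi
    simp [hv, eq_comm (a := i) (b := y)]
  · simp [hvi, Ne.symm hvi, or_comm, eq_comm (a := i) (b := y)]

/-- Encoded stellar subdivision at the face encoded by `k`. -/
def subdivideCode (k : ℕ) (y : Fin 9) (l : List ℕ) : List ℕ :=
  l.flatMap fun t => if faceSubset k t then
    ((List.finRange 9).filter fun v : Fin 9 => k.testBit v).map
      fun v : Fin 9 => (t ^^^ 2 ^ (v : ℕ)) ||| 2 ^ (y : ℕ)
    else [t]

theorem faceSet_subdivideCode (k : ℕ) (y : Fin 9) (l : List ℕ) :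
    faceSet (subdivideCode k y l) = subdivide (face k) y (faceSet l) := by
  ext s
  simp only [faceSet, subdivideCode, subdivide, List.mem_flatMap, Set.mem_ofPred_eq]
  constructor
  · rintro ⟨j, ⟨t, ht, hj⟩, rfl⟩
    split_ifs at hj with h
    · rw [faceSubset_iff] at h
      simp only [List.mem_map, List.mem_filter, List.mem_finRange, true_and] at hj
      obtain ⟨v, hv, rfl⟩ := hj
      rw [← mem_face] at hv
      exact Or.inr ⟨face t, ⟨t, ht, rfl⟩, h, v, hv, insert_erase_face (h hv)⟩
    · rw [faceSubset_iff] at h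
      obtain rfl := List.mem_singleton.1 hj
      exact Or.inl ⟨⟨j, ht, rfl⟩, h⟩
  · rintro (⟨⟨t, ht, rfl⟩, h⟩ | ⟨_, ⟨t, ht, rfl⟩, h, v, hv, rfl⟩)
    · exact ⟨t, ⟨t, ht, by simp [faceSubset_iff, h]⟩, rfl⟩
    · refine ⟨_, ⟨t, ht, ?_⟩, (insert_erase_face (h hv)).symm⟩
      rw [if_pos (faceSubset_iff.2 h)]
      exact List.mem_map.2 ⟨v, by simpa using mem_face.1 hv, rfl⟩

/-- Successive stellar subdivisions, each given by an encoded face and a new vertex. -/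
def subdivideCodes (L : List (ℕ × Fin 9)) (l : List ℕ) : List ℕ :=
  L.foldl (fun l q => subdivideCode q.1 q.2 l) l

/-- The new vertices of successive subdivisions are indeed new. -/
def admissible : List (ℕ × Fin 9) → List ℕ → Bool
  | [], _ => true
  | q :: L, l => (q.1 % 512 != 0) && !q.1.testBit q.2 && (l.all fun s => !s.testBit q.2) &&
      admissible L (subdivideCode q.1 q.2 l)

theorem face_nonempty {k : ℕ} (h : k % 512 ≠ 0) : (face k).Nonempty := by
  by_contra hne
  rw [Finset.not_nonempty_iff_eq_empty] at hne
  have h0 : faceSubset k 0 = true := faceSubset_iff.2 (by simp [hne])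
  simp only [faceSubset, beq_iff_eq, Nat.and_zero] at h0
  exact h h0.symm

theorem diskPair_subdivideCodes_iff (L : List (ℕ × Fin 9)) :
    ∀ {S B : List ℕ}, admissible L S = true → admissible L B = true →
      (DiskPair (faceSet (subdivideCodes L S)) (faceSet (subdivideCodes L B)) ↔
        DiskPair (faceSet S) (faceSet B)) := by
  induction L with
  | nil => exact fun _ _ => Iff.rfl
  | cons q L ih =>
    intro S B hS hB
    simp only [admissible, Bool.and_eq_true, bne_iff_ne, Bool.not_eq_true', List.all_eq_true]
      at hS hB
    obtain ⟨⟨⟨h1, h2⟩, h3⟩, h4⟩ := hS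
    refine (ih h4 hB.2).trans ?_
    rw [faceSet_subdivideCode, faceSet_subdivideCode]
    refine diskPair_subdivide_iff (face_nonempty h1) (by simp [mem_face, h2]) ?_ ?_
    · rintro _ ⟨s, hs, rfl⟩
      simp [mem_face, h3 s hs]
    · rintro _ ⟨s, hs, rfl⟩
      simp [mem_face, hB.1.2 s hs]

/-- Every face encoded in `l` is contained in a face encoded in `l'`. -/
def faceDominated (l l' : List ℕ) : Bool := l.all fun s => l'.any fun t => faceSubset s t

theorem faceDominated_iff {l l' : List ℕ} :
    faceDominated l l' = true ↔ ∀ s ∈ l, ∃ t ∈ l', face s ⊆ face t := by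
  simp [faceDominated, faceSubset_iff]

theorem generated_faceSet_congr {l l' : List ℕ} (h : faceDominated l l' = true)
    (h' : faceDominated l' l = true) : generated (faceSet l) = generated (faceSet l') := by
  rw [faceDominated_iff] at h h'
  refine generated_congr ?_ ?_
  · rintro _ ⟨s, hs, rfl⟩
    obtain ⟨t, ht, hst⟩ := h s hs
    exact ⟨_, ⟨t, ht, rfl⟩, hst⟩
  · rintro _ ⟨s, hs, rfl⟩
    obtain ⟨t, ht, hst⟩ := h' s hs
    exact ⟨_, ⟨t, ht, rfl⟩, hst⟩

/-- The subdivision of the pair `(S, B)` along `L'` agrees with the subdivision of the triangle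
`{0, 1, 2}` and its boundary along `L`. -/
def commonSubdivision (L L' : List (ℕ × Fin 9)) (S B : List ℕ) : Bool :=
  admissible L [7] && admissible L [3, 6, 5] && admissible L' S && admissible L' B &&
    faceDominated (subdivideCodes L [7]) (subdivideCodes L' S) &&
    faceDominated (subdivideCodes L' S) (subdivideCodes L [7]) &&
    faceDominated (subdivideCodes L [3, 6, 5]) (subdivideCodes L' B) &&
    faceDominated (subdivideCodes L' B) (subdivideCodes L [3, 6, 5])

theorem face_codes : face 7 = {0, 1, 2} ∧ face 3 = {0, 1} ∧ face 6 = {1, 2} ∧ face 5 = {0, 2} := by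
  decide

theorem diskPair_of_commonSubdivision (L L' : List (ℕ × Fin 9)) {S B : List ℕ}
    (h : commonSubdivision L L' S B = true) : DiskPair (faceSet S) (faceSet B) := by
  simp only [commonSubdivision, Bool.and_eq_true] at h
  obtain ⟨⟨⟨⟨⟨⟨⟨h1, h2⟩, h3⟩, h4⟩, h5⟩, h6⟩, h7⟩, h8⟩ := h
  refine (diskPair_subdivideCodes_iff L' h3 h4).1
    (((diskPair_subdivideCodes_iff L h1 h2).2 ?_).congr
      (generated_faceSet_congr h5 h6) (generated_faceSet_congr h7 h8))
  obtain ⟨e7, e3, e6, e5⟩ := face_codes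
  have hS : faceSet [7] = {{0, 1, 2}} := by
    ext s
    simp [faceSet, e7, eq_comm]
  have hB : faceSet [3, 6, 5] = {{0, 1}, {1, 2}, {0, 2}} := by
    ext s
    simp [faceSet, e3, e6, e5, eq_comm]
  rw [hS, hB]
  exact diskPair_triangle

/-- Encoded image of a face when the vertex `7` is merged into `p`. -/
def mergeCode (p : Fin 9) (k : ℕ) : ℕ :=
  if k.testBit 7 then (k ^^^ 2 ^ ((7 : Fin 9) : ℕ)) ||| 2 ^ (p : ℕ) else k

theorem image_update_face {p : Fin 9} (k : ℕ) :
    (face k).image (Function.update id 7 p) = face (mergeCode p k) := by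
  unfold mergeCode
  split_ifs with h
  · have h7 : (7 : Fin 9) ∈ face k := mem_face.2 h
    rw [← insert_erase_face (v := 7) h7]
    nth_rw 1 [← insert_erase h7]
    rw [image_insert, Function.update_self]
    congr 1
    conv_rhs => rw [← image_id (s := (face k).erase 7)]
    exact image_congr fun i hi => Function.update_of_ne (mem_erase.1 hi).1 _ _
  · conv_rhs => rw [← image_id (s := face k)]
    refine image_congr fun i hi => Function.update_of_ne ?_ _ _
    rintro rfl
    exact h (mem_face.1 hi)

theorem image_update_faceSet {p : Fin 9} (l : List ℕ) :
    Finset.image (Function.update id 7 p) '' faceSet l = faceSet (l.map (mergeCode p)) := by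
  ext s
  constructor
  · rintro ⟨_, ⟨k, hk, rfl⟩, rfl⟩
    exact ⟨_, List.mem_map_of_mem hk, (image_update_face k).symm⟩
  · rintro ⟨_, hj, rfl⟩
    obtain ⟨k, hk, rfl⟩ := List.mem_map.1 hj
    exact ⟨_, ⟨k, hk, rfl⟩, image_update_face k⟩

/-- A combinatorial model of a disk to be starred, with at most eight vertices, which remains a
disk when the vertex `7` is merged into the vertex `merge`. Faces are encoded by numbers. Every
simplex that contains no member of `core` lies on the boundary. -/
structure DiskPattern where
  triangles : List ℕ
  boundary : List ℕ
  core : List ℕ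
  merge : Fin 9
  support : ℕ
  card_support : (face support).card ≤ 8
  merge_mem : merge ∈ (face support).erase 7
  triangles_subset : faceDominated triangles [support] = true
  boundary_nonempty : boundary ≠ []
  boundary_subset : faceDominated boundary triangles = true
  core_or_boundary : ((List.range 512).all fun k => core.any (faceSubset · k) ||
    boundary.any (faceSubset k) || !triangles.any (faceSubset k)) = true
  disk : DiskPair (faceSet triangles) (faceSet boundary)
  disk_merged : DiskPair (faceSet (triangles.map (mergeCode merge)))
    (faceSet (boundary.map (mergeCode merge)))

/-- The closed star of the vertex `6`, whose link is the hexagon `1, 2, 3, 4, 7, 5`, together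
with the triangle `{0, 1, 2}` attached to it along an edge. -/
def flipPattern : DiskPattern where
  triangles := [70, 76, 88, 208, 224, 98, 7]
  boundary := [5, 12, 24, 144, 160, 34, 3]
  core := [64, 6]
  merge := 4
  support := 255
  card_support := by decide +kernel
  merge_mem := by decide +kernel
  triangles_subset := by decide +kernel
  boundary_nonempty := by decide +kernel
  boundary_subset := by decide +kernel
  core_or_boundary := by decide +kernel
  disk := diskPair_of_commonSubdivision [(7, 6), (6, 3), (10, 4), (18, 5), (48, 7), (65, 8)]
    [(6, 8)] (by decide +kernel)
  disk_merged := diskPair_of_commonSubdivision [(7, 6), (6, 3), (10, 4), (18, 5), (65, 8)]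
    [(6, 8)] (by decide +kernel)

theorem faceSet_flipPattern_triangles : faceSet flipPattern.triangles =
    {{6, 2, 1}, {6, 3, 2}, {6, 4, 3}, {6, 7, 4}, {5, 7, 6}, {5, 6, 1}, {0, 1, 2}} := by
  ext s
  simp only [faceSet, flipPattern, List.mem_cons, List.not_mem_nil, or_false, exists_eq_or_imp,
    exists_eq_left, Set.mem_insert_iff, Set.mem_singleton_iff, Set.mem_ofPred_eq,
    show face 70 = {6, 2, 1} by decide +kernel,
    show face 76 = {6, 3, 2} by decide +kernel,
    show face 88 = {6, 4, 3} by decide +kernel,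
    show face 208 = {6, 7, 4} by decide +kernel,
    show face 224 = {5, 7, 6} by decide +kernel,
    show face 98 = {5, 6, 1} by decide +kernel,
    show face 7 = {0, 1, 2} by decide +kernel,
    eq_comm (b := s)]

theorem faceSet_flipPattern_boundary : faceSet flipPattern.boundary =
    {{0, 2}, {3, 2}, {4, 3}, {7, 4}, {5, 7}, {5, 1}, {0, 1}} := by
  ext s
  simp only [faceSet, flipPattern, List.mem_cons, List.not_mem_nil, or_false, exists_eq_or_imp,
    exists_eq_left, Set.mem_insert_iff, Set.mem_singleton_iff, Set.mem_ofPred_eq,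
    show face 5 = {0, 2} by decide +kernel,
    show face 12 = {3, 2} by decide +kernel,
    show face 24 = {4, 3} by decide +kernel,
    show face 144 = {7, 4} by decide +kernel,
    show face 160 = {5, 7} by decide +kernel,
    show face 34 = {5, 1} by decide +kernel,
    show face 3 = {0, 1} by decide +kernel,
    eq_comm (b := s)]

theorem faceSet_flipPattern_core : faceSet flipPattern.core =
    {{6}, {1, 2}} := by
  ext s
  simp only [faceSet, flipPattern, List.mem_cons, List.not_mem_nil, or_false, exists_eq_or_imp,
    exists_eq_left, Set.mem_insert_iff, Set.mem_singleton_iff, Set.mem_ofPred_eq,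
    show face 64 = {6} by decide +kernel,
    show face 6 = {1, 2} by decide +kernel,
    eq_comm (b := s)]

/-- The union of the closed stars of the adjacent vertices `5` and `6`, whose links are the
square `0, 1, 6, 4` and the hexagon `5, 1, 3, 7, 2, 4`. -/
def contractPattern : DiskPattern where
  triangles := [35, 49, 98, 112, 84, 196, 200, 74]
  boundary := [3, 10, 136, 132, 20, 17]
  core := [32, 64]
  merge := 3
  support := 255
  card_support := by decide +kernel
  merge_mem := by decide +kernel
  triangles_subset := by decide +kernel
  boundary_nonempty := by decide +kernel
  boundary_subset := by decide +kernel
  core_or_boundary := by decide +kernel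
  disk := diskPair_of_commonSubdivision [(7, 6), (6, 3), (12, 7), (5, 4), (65, 5)]
    [] (by decide +kernel)
  disk_merged := diskPair_of_commonSubdivision [(7, 6), (6, 3), (5, 4), (65, 5)]
    [] (by decide +kernel)

theorem faceSet_contractPattern_triangles : faceSet contractPattern.triangles =
    {{0, 1, 5}, {0, 5, 4}, {1, 6, 5}, {6, 4, 5}, {6, 2, 4}, {6, 7, 2}, {6, 3, 7}, {1, 3, 6}} := by
  ext s
  simp only [faceSet, contractPattern, List.mem_cons, List.not_mem_nil, or_false, exists_eq_or_imp,
    exists_eq_left, Set.mem_insert_iff, Set.mem_singleton_iff, Set.mem_ofPred_eq,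
    show face 35 = {0, 1, 5} by decide +kernel,
    show face 49 = {0, 5, 4} by decide +kernel,
    show face 98 = {1, 6, 5} by decide +kernel,
    show face 112 = {6, 4, 5} by decide +kernel,
    show face 84 = {6, 2, 4} by decide +kernel,
    show face 196 = {6, 7, 2} by decide +kernel,
    show face 200 = {6, 3, 7} by decide +kernel,
    show face 74 = {1, 3, 6} by decide +kernel,
    eq_comm (b := s)]

theorem faceSet_contractPattern_boundary : faceSet contractPattern.boundary =
    {{0, 1}, {1, 3}, {3, 7}, {7, 2}, {2, 4}, {0, 4}} := by
  ext s
  simp only [faceSet, contractPattern, List.mem_cons, List.not_mem_nil, or_false, exists_eq_or_imp,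
    exists_eq_left, Set.mem_insert_iff, Set.mem_singleton_iff, Set.mem_ofPred_eq,
    show face 3 = {0, 1} by decide +kernel,
    show face 10 = {1, 3} by decide +kernel,
    show face 136 = {3, 7} by decide +kernel,
    show face 132 = {7, 2} by decide +kernel,
    show face 20 = {2, 4} by decide +kernel,
    show face 17 = {0, 4} by decide +kernel,
    eq_comm (b := s)]

theorem faceSet_contractPattern_core : faceSet contractPattern.core =
    {{5}, {6}} := by
  ext s
  simp only [faceSet, contractPattern, List.mem_cons, List.not_mem_nil, or_false, exists_eq_or_imp,
    exists_eq_left, Set.mem_insert_iff, Set.mem_singleton_iff, Set.mem_ofPred_eq,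
    show face 32 = {5} by decide +kernel,
    show face 64 = {6} by decide +kernel,
    eq_comm (b := s)]

/-- The union of the closed stars of the adjacent vertices `5` and `6`, whose links are the
triangle `0, 2, 6` and the hexagon `5, 0, 1, 3, 7, 2`. -/
def absorbPattern : DiskPattern where
  triangles := [97, 100, 37, 196, 200, 74, 67]
  boundary := [3, 10, 136, 132, 5]
  core := [32, 64]
  merge := 3
  support := 239
  card_support := by decide +kernel
  merge_mem := by decide +kernel
  triangles_subset := by decide +kernel
  boundary_nonempty := by decide +kernel
  boundary_subset := by decide +kernel
  core_or_boundary := by decide +kernel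
  disk := diskPair_of_commonSubdivision [(7, 6), (6, 3), (12, 7), (69, 5)]
    [] (by decide +kernel)
  disk_merged := diskPair_of_commonSubdivision [(7, 6), (6, 3), (69, 5)]
    [] (by decide +kernel)

theorem faceSet_absorbPattern_triangles : faceSet absorbPattern.triangles =
    {{0, 6, 5}, {6, 2, 5}, {0, 5, 2}, {6, 7, 2}, {6, 3, 7}, {1, 3, 6}, {0, 1, 6}} := by
  ext s
  simp only [faceSet, absorbPattern, List.mem_cons, List.not_mem_nil, or_false, exists_eq_or_imp,
    exists_eq_left, Set.mem_insert_iff, Set.mem_singleton_iff, Set.mem_ofPred_eq,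
    show face 97 = {0, 6, 5} by decide +kernel,
    show face 100 = {6, 2, 5} by decide +kernel,
    show face 37 = {0, 5, 2} by decide +kernel,
    show face 196 = {6, 7, 2} by decide +kernel,
    show face 200 = {6, 3, 7} by decide +kernel,
    show face 74 = {1, 3, 6} by decide +kernel,
    show face 67 = {0, 1, 6} by decide +kernel,
    eq_comm (b := s)]

theorem faceSet_absorbPattern_boundary : faceSet absorbPattern.boundary =
    {{0, 1}, {1, 3}, {3, 7}, {7, 2}, {0, 2}} := by
  ext s
  simp only [faceSet, absorbPattern, List.mem_cons, List.not_mem_nil, or_false, exists_eq_or_imp,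
    exists_eq_left, Set.mem_insert_iff, Set.mem_singleton_iff, Set.mem_ofPred_eq,
    show face 3 = {0, 1} by decide +kernel,
    show face 10 = {1, 3} by decide +kernel,
    show face 136 = {3, 7} by decide +kernel,
    show face 132 = {7, 2} by decide +kernel,
    show face 5 = {0, 2} by decide +kernel,
    eq_comm (b := s)]

theorem faceSet_absorbPattern_core : faceSet absorbPattern.core =
    {{5}, {6}} := by
  ext s
  simp only [faceSet, absorbPattern, List.mem_cons, List.not_mem_nil, or_false, exists_eq_or_imp,
    exists_eq_left, Set.mem_insert_iff, Set.mem_singleton_iff, Set.mem_ofPred_eq,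
    show face 32 = {5} by decide +kernel,
    show face 64 = {6} by decide +kernel,
    eq_comm (b := s)]

section Starring

variable {A : Type*}

/-- The restriction of `ι` to the vertices of a pattern is injective, except that it may identify
the vertex `7` with the vertex `merge`. -/
def DiskPattern.IsPlacement (P : DiskPattern) (ι : Fin 9 → A) : Prop :=
  Set.InjOn ι (face P.support) ∨ (ι 7 = ι P.merge ∧ Set.InjOn ι ((face P.support).erase 7))

theorem DiskPattern.subset_support (P : DiskPattern) {s : Finset (Fin 9)}
    (hs : s ∈ faceSet P.triangles) : s ⊆ face P.support := by
  obtain ⟨k, hk, rfl⟩ := hs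
  obtain ⟨l, hl, hkl⟩ := faceDominated_iff.1 P.triangles_subset k hk
  rwa [List.mem_singleton.1 hl] at hkl

theorem DiskPattern.exists_triangle (P : DiskPattern) {s : Finset (Fin 9)}
    (hs : s ∈ faceSet P.boundary) : ∃ t ∈ faceSet P.triangles, s ⊆ t := by
  obtain ⟨k, hk, rfl⟩ := hs
  obtain ⟨l, hl, hkl⟩ := faceDominated_iff.1 P.boundary_subset k hk
  exact ⟨_, ⟨l, hl, rfl⟩, hkl⟩

theorem DiskPattern.exists_core_or_boundary (P : DiskPattern) {s t : Finset (Fin 9)}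
    (ht : t ∈ faceSet P.triangles) (hst : s ⊆ t) :
    (∃ c ∈ faceSet P.core, c ⊆ s) ∨ ∃ e ∈ faceSet P.boundary, s ⊆ e := by
  obtain ⟨k, hk, rfl⟩ := exists_face_eq s
  obtain ⟨l, hl, rfl⟩ := ht
  have h := List.all_eq_true.1 P.core_or_boundary k (List.mem_range.2 hk)
  simp only [Bool.or_eq_true, List.any_eq_true, Bool.not_eq_true', List.any_eq_false,
    faceSubset_iff] at h
  rcases h with (⟨c, hc, hck⟩ | ⟨e, he, hke⟩) | h
  · exact Or.inl ⟨_, ⟨c, hc, rfl⟩, hck⟩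
  · exact Or.inr ⟨_, ⟨e, he, rfl⟩, hke⟩
  · exact absurd hst (h l hl)

theorem DiskPattern.diskPair_image (P : DiskPattern) {ι : Fin 9 → A} (hι : P.IsPlacement ι) :
    DiskPair (Finset.image ι '' faceSet P.triangles) (Finset.image ι '' faceSet P.boundary) := by
  have hB : ∀ s ∈ faceSet P.boundary, s ⊆ face P.support := fun s hs => by
    obtain ⟨t, ht, hst⟩ := P.exists_triangle hs
    exact hst.trans (P.subset_support ht)
  rcases hι with hι | ⟨h7, hι⟩
  · exact P.disk.image ι _ hι (fun s hs => coe_subset.2 (P.subset_support hs))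
      fun s hs => coe_subset.2 (hB s hs)
  · have hcomp : ι ∘ Function.update id 7 P.merge = ι := by
      funext i
      by_cases hi : i = 7
      · subst hi
        simp [h7]
      · simp [hi]
    have hsub : ∀ s : Finset (Fin 9), s ⊆ face P.support →
        s.image (Function.update id 7 P.merge) ⊆ (face P.support).erase 7 := by
      intro s hs i hi
      obtain ⟨j, hj, rfl⟩ := mem_image.1 hi
      by_cases hj7 : j = 7
      · subst hj7
        simpa using P.merge_mem
      · simpa [hj7] using hs hj
    have h := P.disk_merged
    rw [← image_update_faceSet, ← image_update_faceSet] at h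
    have h2 := h.image ι _ hι
      (by
        rintro _ ⟨s, hs, rfl⟩
        exact coe_subset.2 (hsub s (P.subset_support hs)))
      (by
        rintro _ ⟨s, hs, rfl⟩
        exact coe_subset.2 (hsub s (hB s hs)))
    have hcompose : ∀ R : Set (Finset (Fin 9)),
        Finset.image ι '' (Finset.image (Function.update id 7 P.merge) '' R) =
          Finset.image ι '' R := by
      intro R
      rw [Set.image_image]
      refine Set.image_congr fun s _ => ?_
      rw [Finset.image_image, hcomp]
    rwa [hcompose, hcompose] at h2

/-- Replacing a placed pattern by the cone over its boundary is an `8`-starring. -/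
theorem DiskPattern.isStarring (P : DiskPattern) {ι : Fin 9 → A} (hι : P.IsPlacement ι)
    {S S' : Set (Finset A)} {w : A}
    (hPS : ∀ t ∈ faceSet P.triangles, t.image ι ∈ S)
    (hw : ∀ t ∈ S, w ∉ t)
    (hold : ∀ t ∈ S, t ∈ S' ∨ ∃ s ∈ faceSet P.triangles, t = s.image ι)
    (hcone : ∀ e ∈ faceSet P.boundary, insert w (e.image ι) ∈ S')
    (hnew : ∀ t ∈ S', t ∈ S ∨ ∃ e ∈ faceSet P.boundary, t = insert w (e.image ι))
    (hcore : ∀ t ∈ S', ∀ c ∈ faceSet P.core, ¬ c.image ι ⊆ t) :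
    IsStarring 8 (generated S) (generated S') := by
  have hBT : ∀ e ∈ faceSet P.boundary, ∃ t ∈ faceSet P.triangles, e.image ι ⊆ t.image ι := by
    intro e he
    obtain ⟨t, ht, het⟩ := P.exists_triangle he
    exact ⟨t, ht, image_subset_image het⟩
  set D := generated (Finset.image ι '' faceSet P.triangles) with hD
  set bD := generated (Finset.image ι '' faceSet P.boundary) with hbD
  have hinner : ∀ τ ∈ D.faces, τ ∉ bD.faces → ∃ c ∈ faceSet P.core, c.image ι ⊆ τ := by
    rintro τ ⟨hτ, _, ⟨t, ht, rfl⟩, hτt⟩ hτb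
    obtain ⟨s, hst, rfl⟩ := subset_image_iff.1 hτt
    rcases P.exists_core_or_boundary ht (coe_subset.1 hst) with ⟨c, hc, hcs⟩ | ⟨e, he, hse⟩
    · exact ⟨c, hc, image_subset_image hcs⟩
    · exact absurd ⟨hτ, _, ⟨e, he, rfl⟩, image_subset_image hse⟩ hτb
  have hvert : D.vertexSet ⊆ ((face P.support).image ι : Finset A) := by
    rintro v ⟨-, _, ⟨t, ht, rfl⟩, hvt⟩
    exact image_subset_image (P.subset_support ht) (singleton_subset_iff.1 hvt)
  refine ⟨D, bD, 2, w, ?_, (finite_toSet _).subset hvert, ?_, ⟨?_, P.diskPair_image hι⟩, ?_, ?_, ?_⟩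
  · rintro σ ⟨hσ, _, ⟨t, ht, rfl⟩, hσt⟩
    exact ⟨hσ, _, hPS t ht, hσt⟩
  · have h := Set.ncard_le_ncard hvert (finite_toSet _)
    rw [Set.ncard_coe_finset] at h
    exact_mod_cast h.trans (card_image_le.trans P.card_support)
  · rintro σ ⟨hσ, _, ⟨e, he, rfl⟩, hσe⟩
    obtain ⟨t, ht, het⟩ := hBT e he
    exact ⟨hσ, _, ⟨t, ht, rfl⟩, hσe.trans het⟩
  · rintro σ ⟨hσ, t, ht, hσt⟩ τ hτ hτb hτσ
    obtain ⟨c, hc, hcτ⟩ := hinner τ hτ hτb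
    rcases hold t ht with ht' | ⟨s, hs, rfl⟩
    · exact absurd (hcτ.trans (hτσ.trans hσt)) (hcore t ht' c hc)
    · exact ⟨hσ, _, ⟨s, hs, rfl⟩, hσt⟩
  · rintro ⟨-, t, ht, hwt⟩
    exact hw t ht (singleton_subset_iff.1 hwt)
  · ext σ
    constructor
    · rintro ⟨hσ, t, ht, hσt⟩
      rcases hnew t ht with htS | ⟨e, he, rfl⟩
      · refine Or.inl ⟨⟨hσ, t, htS, hσt⟩, ?_⟩
        rintro ⟨hσD, hσb⟩
        obtain ⟨c, hc, hcσ⟩ := hinner σ hσD hσb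
        exact hcore t ht c hc (hcσ.trans hσt)
      · right
        by_cases hwσ : w ∈ σ
        · rw [← insert_erase hwσ]
          have hsub : σ.erase w ⊆ e.image ι := by
            rw [← subset_insert_iff]
            exact hσt
          rcases (σ.erase w).eq_empty_or_nonempty with h0 | h0
          · right
            simp [h0]
          · exact Or.inl (Or.inr ⟨_, ⟨h0, _, ⟨e, he, rfl⟩, hsub⟩, rfl⟩)
        · exact Or.inl (Or.inl ⟨hσ, _, ⟨e, he, rfl⟩, (subset_insert_iff_of_notMem hwσ).1 hσt⟩)
    · rintro (⟨⟨hσ, t, ht, hσt⟩, hnot⟩ | (hσ | ⟨τ, ⟨-, _, ⟨e, he, rfl⟩, hτe⟩, rfl⟩) | hσ)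
      · rcases hold t ht with ht' | ⟨s, hs, rfl⟩
        · exact ⟨hσ, t, ht', hσt⟩
        · have hσb : σ ∈ bD.faces := by
            by_contra hσb
            exact hnot ⟨⟨hσ, _, ⟨s, hs, rfl⟩, hσt⟩, hσb⟩
          obtain ⟨-, _, ⟨e, he, rfl⟩, hσe⟩ := hσb
          exact ⟨hσ, _, hcone e he, hσe.trans (subset_insert _ _)⟩
      · obtain ⟨hσ, _, ⟨e, he, rfl⟩, hσe⟩ := hσ
        exact ⟨hσ, _, hcone e he, hσe.trans (subset_insert _ _)⟩
      · exact ⟨insert_nonempty _ _, _, hcone e he, insert_subset_insert _ hτe⟩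
      · obtain ⟨k, hk⟩ := List.exists_mem_of_ne_nil _ P.boundary_nonempty
        rw [Set.mem_singleton_iff.1 hσ]
        exact ⟨singleton_nonempty _, _, hcone _ ⟨k, hk, rfl⟩,
          singleton_subset_iff.2 (mem_insert_self _ _)⟩

end Starring

theorem DiskPattern.isPlacement_of_leftInverse {A : Type*} (P : DiskPattern) {ι : Fin 9 → A}
    (g : A → Fin 9) (hg : ∀ i ∈ face P.support, i ≠ 7 → g (ι i) = i)
    (h7 : ι 7 = ι P.merge ∨ g (ι 7) = 7) : P.IsPlacement ι := by
  rcases h7 with h7 | h7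
  · refine Or.inr ⟨h7, Set.LeftInvOn.injOn (f₁' := g) fun i hi => ?_⟩
    obtain ⟨hi7, hi⟩ := mem_erase.1 hi
    exact hg i hi hi7
  · refine Or.inl (Set.LeftInvOn.injOn (f₁' := g) fun i hi => ?_)
    by_cases hi7 : i = 7
    · rwa [hi7]
    · exact hg i hi hi7

/-- The vertices of a capped annulus while its two rims `a` and `b` are being replaced by a single
rim `d`. The vertices of the part below the rim `b` are `low x`. -/
inductive RimVertex (L : Type*)
  | top : RimVertex L
  | low (x : L) : RimVertex L
  | a (i : ℕ) : RimVertex L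
  | b (i : ℕ) : RimVertex L
  | d (i : ℕ) : RimVertex L

namespace RimVertex

variable {L : Type*}

/-- The index `i ≤ n` reduced modulo `n`. -/
def wrap (n i : ℕ) : ℕ := if i = n then 0 else i

/-- The rim `a`, indexed cyclically. -/
def outer (n i : ℕ) : RimVertex L := a (wrap n i)

/-- The rim whose vertices with index less than `k` are those of `d` and whose other vertices are
those of `b`, indexed cyclically. -/
def mixed (n k i : ℕ) : RimVertex L := if wrap n i < k then d (wrap n i) else b (wrap n i)

/-- The rim `d` with its last vertex replaced by that of `b`, indexed cyclically. -/
def renewed (n i : ℕ) : RimVertex L :=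
  if wrap n i + 1 = n then b (wrap n i) else d (wrap n i)

/-- The triangles below the rim `β`. -/
inductive BelowTri (n : ℕ) (c : ℕ → L) (R : Set (Finset L)) (β : ℕ → RimVertex L) :
    Finset (RimVertex L) → Prop
  | down (i : ℕ) (hi : i < n) : BelowTri n c R β {β i, low (c i), β (i + 1)}
  | up (i : ℕ) (hi : i < n) : BelowTri n c R β {β (i + 1), low (c i), low (c (i + 1))}
  | rest (t : Finset L) (ht : t ∈ R) : BelowTri n c R β (t.image low)

/-- The triangles of the sphere with rims `a` and `b`. -/
inductive InitialTri (n : ℕ) (c : ℕ → L) (R : Set (Finset L)) : Finset (RimVertex L) → Prop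
  | below {t : Finset (RimVertex L)} (ht : BelowTri n c R (mixed n 0) t) : InitialTri n c R t
  | cap (i : ℕ) (hi : i < n) : InitialTri n c R {top, outer n i, outer n (i + 1)}
  | down (i : ℕ) (hi : i < n) : InitialTri n c R {mixed n 0 i, outer n (i + 1), outer n i}
  | up (i : ℕ) (hi : i < n) : InitialTri n c R {mixed n 0 i, mixed n 0 (i + 1), outer n (i + 1)}

/-- The triangles of the sphere once the vertices `d 0, …, d j` have been introduced. -/
inductive StageTri (n : ℕ) (c : ℕ → L) (R : Set (Finset L)) (j : ℕ) : Finset (RimVertex L) → Prop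
  | below {t : Finset (RimVertex L)} (ht : BelowTri n c R (mixed n (j + 1)) t) : StageTri n c R j t
  | capNew (i : ℕ) (hi : i < j) : StageTri n c R j {top, d i, d (i + 1)}
  | capStep : StageTri n c R j {top, d j, outer n (j + 1)}
  | step : StageTri n c R j {d j, mixed n (j + 1) (j + 1), outer n (j + 1)}
  | cap (i : ℕ) (hi : i < n) (hj : j < i) : StageTri n c R j {top, outer n i, outer n (i + 1)}
  | down (i : ℕ) (hi : i < n) (hj : j < i) :
      StageTri n c R j {mixed n (j + 1) i, outer n (i + 1), outer n i}
  | up (i : ℕ) (hi : i < n) (hj : j < i) :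
      StageTri n c R j {mixed n (j + 1) i, mixed n (j + 1) (i + 1), outer n (i + 1)}
  | close : StageTri n c R j {top, a 0, d 0}

/-- The triangles of the sphere with a single rim. -/
inductive FinalTri (n : ℕ) (c : ℕ → L) (R : Set (Finset L)) : Finset (RimVertex L) → Prop
  | below {t : Finset (RimVertex L)} (ht : BelowTri n c R (renewed n) t) : FinalTri n c R t
  | cap (i : ℕ) (hi : i < n) : FinalTri n c R {top, renewed n i, renewed n (i + 1)}

variable {n : ℕ} {c : ℕ → L} {R : Set (Finset L)}

theorem triple_rotate {A : Type*} (x y z : A) : ({x, y, z} : Finset A) = {y, z, x} := by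
  rw [Finset.insert_comm, Finset.pair_comm x z]

theorem BelowTri.notMem {β : ℕ → RimVertex L} {t : Finset (RimVertex L)} (ht : BelowTri n c R β t)
    {v : RimVertex L} (hv : ∀ x, v ≠ low x) (hβ : ∀ i, v ≠ β i) : v ∉ t := by
  cases ht <;> simp [hv, hβ, Ne.symm (hv _)]

theorem isStarring_contract {j : ℕ} (hn : 3 ≤ n) (hj : j + 1 < n) :
    IsStarring 8 (generated {t | StageTri n c R j t}) (generated {t | StageTri n c R (j + 1) t}) := by
  have e1 : mixed n (j + 1) j = (d j : RimVertex L) := by grind [mixed, wrap]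
  have e2 : mixed n (j + 1) (j + 1) = (b (j + 1) : RimVertex L) := by grind [mixed, wrap]
  have e3 : mixed n (j + 1 + 1) (j + 1) = (d (j + 1) : RimVertex L) := by grind [mixed, wrap]
  have e4 : ∀ i, i ≠ j + 1 → mixed n (j + 1 + 1) i = (mixed n (j + 1) i : RimVertex L) := by
    grind [mixed, wrap]
  have e5 : outer n (j + 1) = (a (j + 1) : RimVertex L) := by grind [outer, wrap]
  have e6 : ∀ i, i ≠ j + 1 → (a (j + 1) : RimVertex L) ≠ outer n i := by grind [outer, wrap]
  have e7 : ∀ i, (b (j + 1) : RimVertex L) ≠ mixed n (j + 1 + 1) i := by grind [mixed, wrap]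
  have e8 : ∀ i, (d (j + 1) : RimVertex L) ≠ mixed n (j + 1) i := by grind [mixed, wrap]
  have e9 : ∀ k i, (a (j + 1) : RimVertex L) ≠ mixed n k i := by grind [mixed]
  have e10 : ∀ i, (b (j + 1) : RimVertex L) ≠ outer n i := by grind [outer]
  have e11 : ∀ i, (d (j + 1) : RimVertex L) ≠ outer n i := by grind [outer]
  have r1 := triple_rotate (d (j + 1) : RimVertex L) top (d j)
  have r2 := triple_rotate (d (j + 1) : RimVertex L) (d j) (low (c j))
  have r3 := Finset.insert_comm (d (j + 1) : RimVertex L) top {outer n (j + 1 + 1)}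
  refine contractPattern.isStarring (ι := ![top, d j, mixed n (j + 1) (j + 1 + 1), low (c j),
    outer n (j + 1 + 1), a (j + 1), b (j + 1), low (c (j + 1)), top]) (w := d (j + 1))
    ?_ ?_ ?_ ?_ ?_ ?_ ?_
  · refine contractPattern.isPlacement_of_leftInverse
      (fun | top => 0 | low x => if x = c j then 3 else 7 | a i => if i = j + 1 then 5 else 4
           | b i => if i = j + 1 then 6 else 2 | d i => if i = j then 1 else 2) ?_ ?_
    · have e12 : mixed n (j + 1) (j + 1 + 1) = (b (j + 1 + 1) : RimVertex L) ∨
          mixed n (j + 1) (j + 1 + 1) = (d 0 : RimVertex L) ∧ 0 ≠ j := by grind [mixed, wrap]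
      have e13 : wrap n (j + 1 + 1) ≠ j + 1 := by grind [wrap]
      intro i hi h7
      fin_cases i
      iterate 2 · simp
      · rcases e12 with h | ⟨h, h0⟩ <;> simp [*]
      iterate 4 · simp [outer, e13]
      · exact absurd rfl h7
      · exact absurd hi (by decide +kernel)
    · by_cases hc : c (j + 1) = c j
      · left
        simp [hc, contractPattern]
      · right
        simp [hc]
  · simp only [faceSet_contractPattern_triangles, Set.mem_insert_iff, Set.mem_singleton_iff,
      forall_eq_or_imp, forall_eq, image_insert, image_singleton, Matrix.cons_val]
    simp only [← e2, ← e5]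
    refine ⟨.capStep, .cap _ hj (by omega), StageTri.step, .down _ hj (by omega),
      .up _ hj (by omega), .below (.down _ hj), .below (.up _ (by omega)), ?_⟩
    rw [← e1]
    exact .below (.down _ (by omega))
  · intro t ht
    cases ht with
    | below ht => exact ht.notMem (by simp) e8
    | _ => simp [e8, e11] <;> omega
  · simp only [faceSet_contractPattern_triangles, Set.mem_insert_iff, Set.mem_singleton_iff,
      exists_eq_or_imp, exists_eq_left, image_insert, image_singleton, Matrix.cons_val]
    intro t ht
    cases ht with
    | below ht =>
      cases ht with
      | down i hi =>
        by_cases h1 : i = j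
        · subst h1
          simp only [e1, e2, or_true]
        · by_cases h2 : i = j + 1
          · subst h2
            simp only [e2, true_or, or_true]
          · left
            rw [← e4 i h2, ← e4 (i + 1) (by omega)]
            exact .below (.down i hi)
      | up i hi =>
        by_cases h1 : i = j
        · subst h1
          simp only [e2, true_or, or_true]
        · left
          rw [← e4 (i + 1) (by omega)]
          exact .below (.up i hi)
      | rest t ht => exact Or.inl (.below (.rest t ht))
    | capNew i hi => exact Or.inl (.capNew i (by omega))
    | capStep => simp only [e5, true_or, or_true]
    | step => simp only [e2, e5, true_or, or_true]
    | cap i hi hji =>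
      by_cases h : i = j + 1
      · subst h
        simp only [e5, true_or, or_true]
      · exact Or.inl (.cap i hi (by omega))
    | down i hi hji =>
      by_cases h : i = j + 1
      · subst h
        simp only [e2, e5, true_or, or_true]
      · rw [← e4 i h]
        exact Or.inl (.down i hi (by omega))
    | up i hi hji =>
      by_cases h : i = j + 1
      · subst h
        simp only [e2, true_or, or_true]
      · rw [← e4 i h, ← e4 (i + 1) (by omega)]
        exact Or.inl (.up i hi (by omega))
    | close => exact Or.inl .close
  · simp only [faceSet_contractPattern_boundary, Set.mem_insert_iff, Set.mem_singleton_iff,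
      forall_eq_or_imp, forall_eq, image_insert, image_singleton, Matrix.cons_val, r1, r2, r3]
    rw [← e4 _ (by omega)]
    refine ⟨.capNew j (by omega), ?_, ?_, ?_, StageTri.step, .capStep⟩
    · rw [← e1, ← e3, ← e4 j (by omega)]
      exact .below (.down j (by omega))
    · rw [← e3]
      exact .below (.up j (by omega))
    · rw [← e3]
      exact .below (.down (j + 1) hj)
  · simp only [faceSet_contractPattern_boundary, Set.mem_insert_iff, Set.mem_singleton_iff,
      exists_eq_or_imp, exists_eq_left, image_insert, image_singleton, Matrix.cons_val, r1, r2, r3]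
    intro t ht
    cases ht with
    | below ht =>
      cases ht with
      | down i hi =>
        by_cases h1 : i = j
        · subst h1
          simp only [e4 i (by omega), e1, e3, true_or, or_true]
        · by_cases h2 : i = j + 1
          · subst h2
            simp only [e3, e4 (j + 1 + 1) (by omega), true_or, or_true]
          · left
            rw [e4 i h2, e4 (i + 1) (by omega)]
            exact .below (.down i hi)
      | up i hi =>
        by_cases h1 : i = j
        · subst h1
          simp only [e3, true_or, or_true]
        · left
          rw [e4 (i + 1) (by omega)]
          exact .below (.up i hi)
      | rest t ht => exact Or.inl (.below (.rest t ht))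
    | capNew i hi =>
      by_cases h : i = j
      · subst h
        simp only [true_or, or_true]
      · exact Or.inl (.capNew i (by omega))
    | capStep => simp only [or_true]
    | step => simp only [e4 (j + 1 + 1) (by omega), true_or, or_true]
    | cap i hi hji => exact Or.inl (.cap i hi (by omega))
    | down i hi hji =>
      rw [e4 i (by omega)]
      exact Or.inl (.down i hi (by omega))
    | up i hi hji =>
      rw [e4 i (by omega), e4 (i + 1) (by omega)]
      exact Or.inl (.up i hi (by omega))
    | close => exact Or.inl .close
  · simp only [faceSet_contractPattern_core, Set.mem_insert_iff, Set.mem_singleton_iff,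
      forall_eq_or_imp, forall_eq, image_singleton, Matrix.cons_val, singleton_subset_iff]
    intro t ht
    cases ht with
    | below ht => exact ⟨ht.notMem (by simp) (e9 _), ht.notMem (by simp) e7⟩
    | _ => simp [e7, e9, e10] <;> grind

theorem isStarring_flip {N : ℕ} (hN : 2 ≤ N) (hc : c (N + 1) = c 0) :
    IsStarring 8 (generated {t | InitialTri (N + 1) c R t})
      (generated {t | StageTri (N + 1) c R 0 t}) := by
  have e1 : mixed (N + 1) 0 0 = (b 0 : RimVertex L) := by grind [mixed, wrap]
  have e2 : mixed (N + 1) 0 (N + 1) = (b 0 : RimVertex L) := by grind [mixed, wrap]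
  have e3 : mixed (N + 1) (0 + 1) 0 = (d 0 : RimVertex L) := by grind [mixed, wrap]
  have e4 : mixed (N + 1) (0 + 1) (N + 1) = (d 0 : RimVertex L) := by grind [mixed, wrap]
  have e5 : ∀ i, i ≠ 0 → i ≠ N + 1 →
      mixed (N + 1) (0 + 1) i = (mixed (N + 1) 0 i : RimVertex L) := by grind [mixed, wrap]
  have e6 : outer (N + 1) 0 = (a 0 : RimVertex L) := by grind [outer, wrap]
  have e7 : outer (N + 1) (N + 1) = (a 0 : RimVertex L) := by grind [outer, wrap]
  have e8 : outer (N + 1) (0 + 1) = (a 1 : RimVertex L) := by grind [outer, wrap]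
  have e9 : ∀ i, (b 0 : RimVertex L) ≠ mixed (N + 1) (0 + 1) i := by grind [mixed, wrap]
  have e10 : ∀ i, (d 0 : RimVertex L) ≠ mixed (N + 1) 0 i := by grind [mixed]
  have e11 : ∀ k i, (a 0 : RimVertex L) ≠ mixed (N + 1) k i := by grind [mixed]
  have e12 : ∀ i, (b 0 : RimVertex L) ≠ outer (N + 1) i := by grind [outer]
  have e13 : ∀ i, (d 0 : RimVertex L) ≠ outer (N + 1) i := by grind [outer]
  have r1 := Finset.insert_comm (d 0 : RimVertex L) top {a 1}
  have r2 := triple_rotate (d 0 : RimVertex L) (mixed (N + 1) 0 N) (low (c N))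
  have r3 := Finset.insert_comm (d 0 : RimVertex L) (mixed (N + 1) 0 N) {a 0}
  have r4 := triple_rotate (d 0 : RimVertex L) top (a 0)
  refine flipPattern.isStarring (ι := ![top, a 0, a 1, mixed (N + 1) 0 (0 + 1), low (c 0),
    mixed (N + 1) 0 N, b 0, low (c N), top]) (w := d 0) ?_ ?_ ?_ ?_ ?_ ?_ ?_
  · refine flipPattern.isPlacement_of_leftInverse
      (fun | top => 0 | low x => if x = c 0 then 4 else 7 | a i => if i = 0 then 1 else 2
           | b i => if i = 0 then 6 else if i = 1 then 3 else 5 | d _ => 8) ?_ ?_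
    · have h1 : mixed (N + 1) 0 (0 + 1) = (b 1 : RimVertex L) := by grind [mixed, wrap]
      have h2 : mixed (N + 1) 0 N = (b N : RimVertex L) := by grind [mixed, wrap]
      intro i hi h7
      fin_cases i
      iterate 5 · simp [h1]
      · simp [h2, show N ≠ 0 by omega, show N ≠ 1 by omega]
      · simp
      · exact absurd rfl h7
      · exact absurd hi (by decide +kernel)
    · by_cases h : c N = c 0
      · left
        simp [h, flipPattern]
      · right
        simp [h]
  · simp only [faceSet_flipPattern_triangles, Set.mem_insert_iff, Set.mem_singleton_iff,
      forall_eq_or_imp, forall_eq, image_insert, image_singleton, Matrix.cons_val]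
    refine ⟨?_, ?_, ?_, ?_, ?_, ?_, ?_⟩
    · rw [← e1, ← e6, ← e8]
      exact .down 0 N.succ_pos
    · rw [← e1, ← e8]
      exact .up 0 N.succ_pos
    · rw [← e1]
      exact .below (.down 0 N.succ_pos)
    · rw [← e2, ← hc]
      exact .below (.up N N.lt_succ_self)
    · rw [← e2]
      exact .below (.down N N.lt_succ_self)
    · rw [← e2, ← e7]
      exact .up N N.lt_succ_self
    · rw [← e6, ← e8]
      exact .cap 0 N.succ_pos
  · intro t ht
    cases ht with
    | below ht => exact ht.notMem (by simp) e10
    | _ => simp [e10, e13]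
  · simp only [faceSet_flipPattern_triangles, Set.mem_insert_iff, Set.mem_singleton_iff,
      exists_eq_or_imp, exists_eq_left, image_insert, image_singleton, Matrix.cons_val]
    intro t ht
    cases ht with
    | below ht =>
      cases ht with
      | down i hi =>
        by_cases h1 : i = 0
        · subst h1
          simp only [e1, true_or, or_true]
        · by_cases h2 : i = N
          · subst h2
            simp only [e2, true_or, or_true]
          · left
            rw [← e5 i h1 (by omega), ← e5 (i + 1) (by omega) (by omega)]
            exact .below (.down i hi)
      | up i hi =>
        by_cases h : i = N
        · subst h
          simp only [e2, hc, true_or, or_true]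
        · left
          rw [← e5 (i + 1) (by omega) (by omega)]
          exact .below (.up i hi)
      | rest t ht => exact Or.inl (.below (.rest t ht))
    | cap i hi =>
      by_cases h : i = 0
      · subst h
        simp only [e6, e8, or_true]
      · exact Or.inl (.cap i hi (by omega))
    | down i hi =>
      by_cases h : i = 0
      · subst h
        simp only [e1, e6, e8, true_or, or_true]
      · rw [← e5 i h (by omega)]
        exact Or.inl (.down i hi (by omega))
    | up i hi =>
      by_cases h1 : i = 0
      · subst h1
        simp only [e1, e8, true_or, or_true]
      · by_cases h2 : i = N
        · subst h2
          simp only [e2, e7, true_or, or_true]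
        · rw [← e5 i h1 (by omega), ← e5 (i + 1) (by omega) (by omega)]
          exact Or.inl (.up i hi (by omega))
  · simp only [faceSet_flipPattern_boundary, Set.mem_insert_iff, Set.mem_singleton_iff,
      forall_eq_or_imp, forall_eq, image_insert, image_singleton, Matrix.cons_val, r1, r2, r3, r4]
    rw [← e5 (0 + 1) (by omega) (by omega), ← e5 N (by omega) (by omega), ← e8]
    refine ⟨.capStep, StageTri.step, ?_, ?_, ?_, ?_, .close⟩
    · rw [← e3]
      exact .below (.down 0 N.succ_pos)
    · rw [← e4, ← hc]
      exact .below (.up N N.lt_succ_self)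
    · rw [← e4]
      exact .below (.down N N.lt_succ_self)
    · rw [← e4, ← e7]
      exact .up N N.lt_succ_self (by omega)
  · simp only [faceSet_flipPattern_boundary, Set.mem_insert_iff, Set.mem_singleton_iff,
      exists_eq_or_imp, exists_eq_left, image_insert, image_singleton, Matrix.cons_val,
      r1, r2, r3, r4]
    intro t ht
    cases ht with
    | below ht =>
      cases ht with
      | down i hi =>
        by_cases h1 : i = 0
        · subst h1
          simp only [e3, e5 (0 + 1) (by omega) (by omega), true_or, or_true]
        · by_cases h2 : i = N
          · subst h2
            simp only [e4, e5 i h1 (by omega), true_or, or_true]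
          · left
            rw [e5 i h1 (by omega), e5 (i + 1) (by omega) (by omega)]
            exact .below (.down i hi)
      | up i hi =>
        by_cases h : i = N
        · subst h
          simp only [e4, hc, true_or, or_true]
        · left
          rw [e5 (i + 1) (by omega) (by omega)]
          exact .below (.up i hi)
      | rest t ht => exact Or.inl (.below (.rest t ht))
    | capNew i hi => omega
    | capStep => simp only [e8, true_or, or_true]
    | step => simp only [e8, e5 (0 + 1) (by omega) (by omega), true_or, or_true]
    | cap i hi h0 => exact Or.inl (.cap i hi)
    | down i hi h0 =>
      rw [e5 i (by omega) (by omega)]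
      exact Or.inl (.down i hi)
    | up i hi h0 =>
      by_cases h : i = N
      · subst h
        simp only [e4, e7, e5 i (by omega) (by omega), true_or, or_true]
      · rw [e5 i (by omega) (by omega), e5 (i + 1) (by omega) (by omega)]
        exact Or.inl (.up i hi)
    | close => simp only [or_true]
  · simp only [faceSet_flipPattern_core, Set.mem_insert_iff, Set.mem_singleton_iff,
      forall_eq_or_imp, forall_eq, image_insert, image_singleton, Matrix.cons_val,
      singleton_subset_iff, insert_subset_iff, not_and]
    intro t ht
    cases ht with
    | below ht =>
      exact ⟨ht.notMem (by simp) e9, fun h => absurd h (ht.notMem (by simp) (e11 _))⟩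
    | _ => simp [e9, e11, e12, -zero_add, -Nat.reduceAdd] <;> grind [outer, wrap, mixed]

theorem isStarring_absorb {M : ℕ} (hM : 1 ≤ M) :
    IsStarring 8 (generated {t | StageTri (M + 1 + 1) c R (M + 1) t})
      (generated {t | FinalTri (M + 1 + 1) c R t}) := by
  have e1 : ∀ i, i ≤ M + 1 → mixed (M + 1 + 1) (M + 1 + 1) i = (d i : RimVertex L) := by
    grind [mixed, wrap]
  have e2 : mixed (M + 1 + 1) (M + 1 + 1) (M + 1 + 1) = (d 0 : RimVertex L) := by
    grind [mixed, wrap]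
  have e3 : ∀ i, i ≤ M → renewed (M + 1 + 1) i = (d i : RimVertex L) := by grind [renewed, wrap]
  have e4 : renewed (M + 1 + 1) (M + 1) = (b (M + 1) : RimVertex L) := by grind [renewed, wrap]
  have e5 : renewed (M + 1 + 1) (M + 1 + 1) = (d 0 : RimVertex L) := by grind [renewed, wrap]
  have e6 : outer (M + 1 + 1) (M + 1 + 1) = (a 0 : RimVertex L) := by grind [outer, wrap]
  have e7 : ∀ i, (b (M + 1) : RimVertex L) ≠ mixed (M + 1 + 1) (M + 1 + 1) i := by
    grind [mixed, wrap]
  have e8 : ∀ i, (b (M + 1) : RimVertex L) ≠ outer (M + 1 + 1) i := by grind [outer]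
  have e9 : ∀ i, (d (M + 1) : RimVertex L) ≠ renewed (M + 1 + 1) i := by grind [renewed, wrap]
  have e10 : ∀ i, (a 0 : RimVertex L) ≠ renewed (M + 1 + 1) i := by grind [renewed]
  have r1 := triple_rotate (b (M + 1) : RimVertex L) top (d M)
  have r2 := triple_rotate (b (M + 1) : RimVertex L) (d M) (low (c M))
  have r3 := Finset.insert_comm (b (M + 1) : RimVertex L) top {d 0}
  refine absorbPattern.isStarring (ι := ![top, d M, d 0, low (c M), top, a 0, d (M + 1),
    low (c (M + 1)), top]) (w := b (M + 1)) ?_ ?_ ?_ ?_ ?_ ?_ ?_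
  · refine absorbPattern.isPlacement_of_leftInverse
      (fun | top => 0 | low x => if x = c M then 3 else 7 | a _ => 5 | b _ => 8
           | d i => if i = 0 then 2 else if i = M then 1 else 6) ?_ ?_
    · intro i hi h7
      fin_cases i
      iterate 4 · simp [show M ≠ 0 by omega]
      · exact absurd hi (by decide +kernel)
      iterate 2 · simp
      · exact absurd rfl h7
      · exact absurd hi (by decide +kernel)
    · by_cases h : c (M + 1) = c M
      · left
        simp [h, absorbPattern]
      · right
        simp [h]
  · simp only [faceSet_absorbPattern_triangles, Set.mem_insert_iff, Set.mem_singleton_iff,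
      forall_eq_or_imp, forall_eq, image_insert, image_singleton, Matrix.cons_val]
    refine ⟨?_, ?_, .close, ?_, ?_, ?_, .capNew M (by omega)⟩
    · rw [← e6]
      exact .capStep
    · rw [← e6, ← e2]
      exact StageTri.step
    · rw [← e1 (M + 1) le_rfl, ← e2]
      exact .below (.down (M + 1) (by omega))
    · rw [← e1 (M + 1) le_rfl]
      exact .below (.up M (by omega))
    · rw [← e1 (M + 1) le_rfl, ← e1 M (by omega)]
      exact .below (.down M (by omega))
  · intro t ht
    cases ht with
    | below ht => exact ht.notMem (by simp) e7
    | _ => simp [e7, e8]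
  · simp only [faceSet_absorbPattern_triangles, Set.mem_insert_iff, Set.mem_singleton_iff,
      exists_eq_or_imp, exists_eq_left, image_insert, image_singleton, Matrix.cons_val]
    intro t ht
    cases ht with
    | below ht =>
      cases ht with
      | down i hi =>
        rcases (by omega : i < M ∨ i = M ∨ i = M + 1) with h | rfl | rfl
        · left
          rw [e1 i (by omega), e1 (i + 1) (by omega), ← e3 i (by omega), ← e3 (i + 1) (by omega)]
          exact .below (.down i hi)
        · simp only [e1 i (by omega), e1 (i + 1) (by omega), true_or, or_true]
        · simp only [e1 (M + 1) le_rfl, e2, true_or, or_true]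
      | up i hi =>
        rcases (by omega : i < M ∨ i = M ∨ i = M + 1) with h | rfl | rfl
        · left
          rw [e1 (i + 1) (by omega), ← e3 (i + 1) (by omega)]
          exact .below (.up i hi)
        · simp only [e1 (i + 1) (by omega), true_or, or_true]
        · left
          rw [e2, ← e5]
          exact .below (.up (M + 1) hi)
      | rest t ht => exact Or.inl (.below (.rest t ht))
    | capNew i hi =>
      by_cases h : i = M
      · subst h
        simp only [or_true]
      · left
        rw [← e3 i (by omega), ← e3 (i + 1) (by omega)]
        exact .cap i (by omega)
    | capStep => simp only [e6, true_or, or_true]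
    | step => simp only [e2, e6, true_or, or_true]
    | close => simp only [true_or, or_true]
    | _ => omega
  · simp only [faceSet_absorbPattern_boundary, Set.mem_insert_iff, Set.mem_singleton_iff,
      forall_eq_or_imp, forall_eq, image_insert, image_singleton, Matrix.cons_val, r1, r2, r3]
    rw [← e3 M le_rfl, ← e4, ← e5]
    exact ⟨.cap M (by omega), .below (.down M (by omega)), .below (.up M (by omega)),
      .below (.down (M + 1) (by omega)), .cap (M + 1) (by omega)⟩
  · simp only [faceSet_absorbPattern_boundary, Set.mem_insert_iff, Set.mem_singleton_iff,
      exists_eq_or_imp, exists_eq_left, image_insert, image_singleton, Matrix.cons_val, r1, r2, r3]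
    intro t ht
    cases ht with
    | below ht =>
      cases ht with
      | down i hi =>
        rcases (by omega : i < M ∨ i = M ∨ i = M + 1) with h | rfl | rfl
        · left
          rw [e3 i (by omega), e3 (i + 1) (by omega), ← e1 i (by omega), ← e1 (i + 1) (by omega)]
          exact .below (.down i hi)
        · simp only [e3 i le_rfl, e4, true_or, or_true]
        · simp only [e4, e5, true_or, or_true]
      | up i hi =>
        rcases (by omega : i < M ∨ i = M ∨ i = M + 1) with h | rfl | rfl
        · left
          rw [e3 (i + 1) (by omega), ← e1 (i + 1) (by omega)]
          exact .below (.up i hi)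
        · simp only [e4, true_or, or_true]
        · left
          rw [e5, ← e2]
          exact .below (.up (M + 1) hi)
      | rest t ht => exact Or.inl (.below (.rest t ht))
    | cap i hi =>
      rcases (by omega : i < M ∨ i = M ∨ i = M + 1) with h | rfl | rfl
      · left
        rw [e3 i (by omega), e3 (i + 1) (by omega)]
        exact .capNew i (by omega)
      · simp only [e3 i le_rfl, e4, true_or, or_true]
      · simp only [e4, e5, or_true]
  · simp only [faceSet_absorbPattern_core, Set.mem_insert_iff, Set.mem_singleton_iff,
      forall_eq_or_imp, forall_eq, image_singleton, Matrix.cons_val, singleton_subset_iff]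
    intro t ht
    cases ht with
    | below ht => exact ⟨ht.notMem (by simp) e10, ht.notMem (by simp) e9⟩
    | _ => simp [e9, e10]

theorem starsTo_finalTri (hn : 3 ≤ n) (hc : c n = c 0) :
    StarsTo 8 (generated {t | InitialTri n c R t}) (generated {t | FinalTri n c R t}) := by
  obtain ⟨M, rfl⟩ : ∃ M, n = M + 1 + 1 := ⟨n - 2, by omega⟩
  have h : ∀ j, j < M + 1 + 1 → StarsTo 8 (generated {t | InitialTri (M + 1 + 1) c R t})
      (generated {t | StageTri (M + 1 + 1) c R j t}) := by
    intro j
    induction j with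
    | zero => exact fun _ => Relation.ReflTransGen.single (isStarring_flip (by omega) hc)
    | succ j ih => exact fun hj => (ih (by omega)).tail (isStarring_contract hn hj)
  exact (h (M + 1) (by omega)).tail (isStarring_absorb (by omega))

end RimVertex

theorem iso_generated {A B : Type*} [hB : DecidableEq B] {S : Set (Finset A)}
    {T : Set (Finset B)} (f : A → B) (g : B → A) (hgf : ∀ s ∈ S, ∀ v ∈ s, g (f v) = v)
    (hf : ∀ s ∈ S, ∃ t ∈ T, s.image f ⊆ t)
    (hT : ∀ t ∈ T, ∃ s ∈ S, t ⊆ s.image f) : Iso (generated S) (generated T) := by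
  obtain rfl : hB = fun a b => Classical.propDecidable (a = b) := Subsingleton.elim _ _
  refine ⟨f, Set.LeftInvOn.injOn (f₁' := g) ?_, ?_, ?_⟩
  · rintro v ⟨-, s, hs, hvs⟩
    exact hgf s hs v (singleton_subset_iff.1 hvs)
  · rintro σ ⟨hσ, s, hs, hσs⟩
    obtain ⟨t, ht, hst⟩ := hf s hs
    exact ⟨hσ.image f, t, ht, (image_subset_image hσs).trans hst⟩
  · rintro τ ⟨hτ, t, ht, hτt⟩
    obtain ⟨s, hs, hts⟩ := hT t ht
    obtain ⟨σ, hσ, rfl⟩ := subset_image_iff.1 (hτt.trans hts)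
    exact ⟨σ, ⟨image_nonempty.1 hτ, s, hs, coe_subset.1 hσ⟩, rfl⟩

section Grid

variable (n p m : ℕ)

/-- The vertex in column `k` and row `j` of `Mnm n m`. -/
def gridVertex (k j : ℕ) : Bool ⊕ ZMod n × Fin (m + 1) := Sum.inr (k, Fin.ofNat (m + 1) j)

/-- The lower neighbours of the rim in row `p`. -/
def belowRim (k : ℕ) : Option (ZMod n × ℕ) := if p = 0 then none else some (k, p - 1)

/-- The triangles with all vertices below row `p`. -/
def belowRows : Set (Finset (Option (ZMod n × ℕ))) :=
  {t | (∃ k j : ℕ, k < n ∧ j + 1 < p ∧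
      (t = {some ((k : ZMod n), j), some (((k + 1 : ℕ) : ZMod n), j),
          some (((k + 1 : ℕ) : ZMod n), j + 1)} ∨
        t = {some ((k : ZMod n), j), some (((k + 1 : ℕ) : ZMod n), j + 1),
          some ((k : ZMod n), j + 1)})) ∨
    (0 < p ∧ ∃ k < n, t = {none, some ((k : ZMod n), 0), some (((k + 1 : ℕ) : ZMod n), 0)})}

/-- The position in `Mnm n m` of the vertices of a capped annulus whose rims lie in the rows
`p` and `p + 1`. -/
def position : RimVertex (Option (ZMod n × ℕ)) → Bool ⊕ ZMod n × Fin (m + 1)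
  | .top => Sum.inl true
  | .low none => Sum.inl false
  | .low (some (i, j)) => Sum.inr (i, Fin.ofNat (m + 1) j)
  | .a i => gridVertex n m i (p + 1)
  | .b i => gridVertex n m i p
  | .d i => gridVertex n m i p

/-- The inverse of `position`, given the rim in row `p`. -/
def vertexAt (ρ : ℕ → RimVertex (Option (ZMod n × ℕ))) :
    Bool ⊕ ZMod n × Fin (m + 1) → RimVertex (Option (ZMod n × ℕ))
  | Sum.inl true => .top
  | Sum.inl false => .low none
  | Sum.inr (i, j) => if (j : ℕ) = p + 1 then .a i.val else if (j : ℕ) = p then ρ i.val else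
      .low (some (i, j))

variable {n p m}

theorem mem_MnmTri_iff [NeZero n] {t : Finset (Bool ⊕ ZMod n × Fin (m + 1))} :
    t ∈ MnmTri n m ↔
      (∃ k j, k < n ∧ j < m ∧
        (t = {gridVertex n m k j, gridVertex n m (k + 1) j, gridVertex n m (k + 1) (j + 1)} ∨
        t = {gridVertex n m k j, gridVertex n m (k + 1) (j + 1), gridVertex n m k (j + 1)})) ∨
      (∃ k < n, t = {Sum.inl false, gridVertex n m k 0, gridVertex n m (k + 1) 0}) ∨
      (∃ k < n, t = {Sum.inl true, gridVertex n m k m, gridVertex n m (k + 1) m}) := by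
  have hlev : ∀ (j : ℕ) (hj : j < m + 1), Fin.ofNat (m + 1) j = ⟨j, hj⟩ := fun j hj =>
    Fin.ext (Nat.mod_eq_of_lt hj)
  have hex : ∀ P : ZMod n → Prop, (∃ i, P i) ↔ ∃ k < n, P (k : ℕ) := fun P =>
    ⟨fun ⟨i, hi⟩ => ⟨i.val, i.val_lt, by rwa [ZMod.natCast_zmod_val]⟩, fun ⟨k, _, hk⟩ => ⟨k, hk⟩⟩
  unfold MnmTri gridVertex
  rw [Set.mem_ofPred_eq, hex, hex, hex]
  refine or_congr ⟨?_, ?_⟩ (or_congr ?_ ?_)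
  · rintro ⟨k, hk, j, hj, h⟩
    refine ⟨k, j, hk, hj, ?_⟩
    rwa [hlev j (by omega), hlev (j + 1) (by omega), Nat.cast_succ]
  · rintro ⟨k, j, hk, hj, h⟩
    refine ⟨k, hk, j, hj, ?_⟩
    rwa [hlev j (by omega), hlev (j + 1) (by omega), Nat.cast_succ] at h
  · simp only [hlev 0 (by omega), Nat.cast_succ]
  · simp only [hlev m (by omega), Nat.cast_succ]

open RimVertex

theorem cast_wrap (k : ℕ) : ((wrap n k : ℕ) : ZMod n) = k := by
  unfold wrap
  split_ifs with h <;> simp [h]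

theorem val_cast_eq_wrap [NeZero n] {k : ℕ} (hk : k ≤ n) : (k : ZMod n).val = wrap n k := by
  rw [ZMod.val_natCast]
  unfold wrap
  split_ifs with h
  · simp [h]
  · exact Nat.mod_eq_of_lt (by omega)

theorem position_outer (k : ℕ) : position n p m (outer n k) = gridVertex n m k (p + 1) := by
  simp [position, outer, gridVertex, cast_wrap]

theorem position_mixed (l k : ℕ) : position n p m (mixed n l k) = gridVertex n m k p := by
  unfold mixed
  split_ifs <;> simp [position, gridVertex, cast_wrap]

theorem position_renewed (k : ℕ) : position n p m (renewed n k) = gridVertex n m k p := by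
  unfold renewed
  split_ifs <;> simp [position, gridVertex, cast_wrap]

theorem position_belowRim_zero (k : ℕ) : position n 0 m (.low (belowRim n 0 k)) = Sum.inl false :=
  rfl

theorem position_belowRim_succ (k : ℕ) :
    position n (p + 1) m (.low (belowRim n (p + 1) k)) = gridVertex n m k p := rfl

theorem vertexAt_gridVertex {ρ : ℕ → RimVertex (Option (ZMod n × ℕ))} {k j : ℕ} (hj : j ≤ m) :
    vertexAt n p m ρ (gridVertex n m k j) = if j = p + 1 then .a (k : ZMod n).val else
      if j = p then ρ (k : ZMod n).val else .low (some ((k : ZMod n), j)) := by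
  have h : j % (m + 1) = j := Nat.mod_eq_of_lt (by omega)
  simp [vertexAt, gridVertex, h]

theorem vertexAt_position_low {ρ : ℕ → RimVertex (Option (ZMod n × ℕ))} (hpm : p ≤ m)
    {x : Option (ZMod n × ℕ)} (hx : ∀ i j, x = some (i, j) → j < p) :
    vertexAt n p m ρ (position n p m (.low x)) = .low x := by
  rcases x with _ | ⟨i, j⟩
  · rfl
  · have hj := hx i j rfl
    have h : j % (m + 1) = j := Nat.mod_eq_of_lt (by omega)
    simp [vertexAt, position, h, show j ≠ p + 1 by omega, show j ≠ p by omega]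

variable {β : ℕ → RimVertex (Option (ZMod n × ℕ))}

theorem vertexAt_position_of_belowTri {ρ : ℕ → RimVertex (Option (ZMod n × ℕ))} (hpm : p ≤ m)
    (hβ : ∀ k, position n p m (β k) = gridVertex n m k p)
    (hρ : ∀ k ≤ n, ρ (k : ZMod n).val = β k) {t : Finset (RimVertex (Option (ZMod n × ℕ)))}
    (ht : BelowTri n (belowRim n p) (belowRows n p) β t) :
    ∀ v ∈ t, vertexAt n p m ρ (position n p m v) = v := by
  have h1 : ∀ k ≤ n, vertexAt n p m ρ (position n p m (β k)) = β k := by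
    intro k hk
    rw [hβ, vertexAt_gridVertex hpm, if_neg (by omega), if_pos rfl, hρ k hk]
  have h2 : ∀ k, vertexAt n p m ρ (position n p m (.low (belowRim n p k))) =
      .low (belowRim n p k) := by
    intro k
    refine vertexAt_position_low hpm fun i j h => ?_
    unfold belowRim at h
    split_ifs at h with h0
    obtain ⟨-, rfl⟩ := Prod.mk.inj (Option.some.inj h)
    omega
  intro v hv
  cases ht with
  | down k hk =>
    simp only [mem_insert, mem_singleton] at hv
    rcases hv with rfl | rfl | rfl
    exacts [h1 k (by omega), h2 k, h1 (k + 1) (by omega)]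
  | up k hk =>
    simp only [mem_insert, mem_singleton] at hv
    rcases hv with rfl | rfl | rfl
    exacts [h1 (k + 1) (by omega), h2 k, h2 (k + 1)]
  | rest t ht =>
    obtain ⟨x, hx, rfl⟩ := mem_image.1 hv
    refine vertexAt_position_low hpm ?_
    rintro i j rfl
    rcases ht with ⟨k, l, hk, hl, rfl | rfl⟩ | ⟨hp, k, hk, rfl⟩ <;>
    · simp at hx
      omega

theorem exists_MnmTri_of_belowTri [NeZero n] (hpm : p ≤ m)
    (hβ : ∀ k, position n p m (β k) = gridVertex n m k p)
    {t : Finset (RimVertex (Option (ZMod n × ℕ)))}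
    (ht : BelowTri n (belowRim n p) (belowRows n p) β t) :
    ∃ s ∈ MnmTri n m, t.image (position n p m) ⊆ s := by
  cases ht with
  | down k hk =>
    rcases p with _ | p
    · refine ⟨_, mem_MnmTri_iff.2 (Or.inr (Or.inl ⟨k, hk, rfl⟩)), ?_⟩
      simp [hβ, position_belowRim_zero, insert_subset_iff]
    · refine ⟨_, mem_MnmTri_iff.2 (Or.inl ⟨k, p, hk, by omega, Or.inr rfl⟩), ?_⟩
      simp [hβ, position_belowRim_succ, insert_subset_iff]
  | up k hk =>
    rcases p with _ | p
    · refine ⟨_, mem_MnmTri_iff.2 (Or.inr (Or.inl ⟨k, hk, rfl⟩)), ?_⟩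
      simp [hβ, position_belowRim_zero, insert_subset_iff]
    · refine ⟨_, mem_MnmTri_iff.2 (Or.inl ⟨k, p, hk, by omega, Or.inl rfl⟩), ?_⟩
      simp [hβ, position_belowRim_succ, insert_subset_iff]
  | rest t ht =>
    rcases ht with ⟨k, j, hk, hj, rfl | rfl⟩ | ⟨hp, k, hk, rfl⟩
    · refine ⟨_, mem_MnmTri_iff.2 (Or.inl ⟨k, j, hk, by omega, Or.inl rfl⟩), ?_⟩
      simp [position, gridVertex]
    · refine ⟨_, mem_MnmTri_iff.2 (Or.inl ⟨k, j, hk, by omega, Or.inr rfl⟩), ?_⟩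
      simp [position, gridVertex]
    · refine ⟨_, mem_MnmTri_iff.2 (Or.inr (Or.inl ⟨k, hk, rfl⟩)), ?_⟩
      simp [position, gridVertex]

theorem exists_belowTri_of_grid (hβ : ∀ k, position n p m (β k) = gridVertex n m k p) {k j : ℕ}
    (hk : k < n) (hj : j < p) {s : Finset (Bool ⊕ ZMod n × Fin (m + 1))}
    (hs : s = {gridVertex n m k j, gridVertex n m (k + 1) j, gridVertex n m (k + 1) (j + 1)} ∨
      s = {gridVertex n m k j, gridVertex n m (k + 1) (j + 1), gridVertex n m k (j + 1)}) :
    ∃ t, BelowTri n (belowRim n p) (belowRows n p) β t ∧ s ⊆ t.image (position n p m) := by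
  by_cases hjp : j + 1 = p
  · subst hjp
    rcases hs with rfl | rfl
    · refine ⟨_, .up k hk, ?_⟩
      simp [hβ, position_belowRim_succ, insert_subset_iff]
    · refine ⟨_, .down k hk, ?_⟩
      simp [hβ, position_belowRim_succ, insert_subset_iff]
  · rcases hs with rfl | rfl
    · refine ⟨_, .rest _ (Or.inl ⟨k, j, hk, by omega, Or.inl rfl⟩), ?_⟩
      simp [position, gridVertex]
    · refine ⟨_, .rest _ (Or.inl ⟨k, j, hk, by omega, Or.inr rfl⟩), ?_⟩
      simp [position, gridVertex]

theorem exists_belowTri_of_cap (hβ : ∀ k, position n p m (β k) = gridVertex n m k p) {k : ℕ}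
    (hk : k < n) : ∃ t, BelowTri n (belowRim n p) (belowRows n p) β t ∧
      {Sum.inl false, gridVertex n m k 0, gridVertex n m (k + 1) 0} ⊆
        t.image (position n p m) := by
  rcases p.eq_zero_or_pos with rfl | hp
  · refine ⟨_, .down k hk, ?_⟩
    simp [hβ, position_belowRim_zero, insert_subset_iff]
  · refine ⟨_, .rest _ (Or.inr ⟨hp, k, hk, rfl⟩), ?_⟩
    simp [position, gridVertex]

theorem iso_initialTri [NeZero n] :
    Iso (generated {t | InitialTri n (belowRim n p) (belowRows n p) t}) (Mnm n (p + 1)) := by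
  have hβ : ∀ k, position n p (p + 1) (mixed n 0 k) = gridVertex n (p + 1) k p := position_mixed 0
  have hα := position_outer (n := n) (p := p) (m := p + 1)
  have hmixed : ∀ k, k ≤ n → b (k : ZMod n).val = (mixed n 0 k : RimVertex (Option (ZMod n × ℕ))) :=
    fun k hk => by simp [val_cast_eq_wrap hk, mixed]
  refine iso_generated (T := MnmTri n (p + 1)) (position n p (p + 1)) (vertexAt n p (p + 1) b)
    ?_ ?_ ?_
  · have h1 : ∀ k ≤ n, vertexAt n p (p + 1) b (position n p (p + 1) (outer n k)) = outer n k := by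
      intro k hk
      rw [hα, vertexAt_gridVertex le_rfl, if_pos rfl, val_cast_eq_wrap hk, outer]
    have h2 : ∀ k ≤ n, vertexAt n p (p + 1) b (position n p (p + 1) (mixed n 0 k)) =
        mixed n 0 k := by
      intro k hk
      rw [hβ, vertexAt_gridVertex (by omega), if_neg (by omega), if_pos rfl, hmixed k hk]
    intro t ht v hv
    cases ht with
    | below ht => exact vertexAt_position_of_belowTri (by omega) hβ hmixed ht v hv
    | cap k hk =>
      simp only [mem_insert, mem_singleton] at hv
      rcases hv with rfl | rfl | rfl
      exacts [rfl, h1 k (by omega), h1 (k + 1) (by omega)]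
    | down k hk =>
      simp only [mem_insert, mem_singleton] at hv
      rcases hv with rfl | rfl | rfl
      exacts [h2 k (by omega), h1 (k + 1) (by omega), h1 k (by omega)]
    | up k hk =>
      simp only [mem_insert, mem_singleton] at hv
      rcases hv with rfl | rfl | rfl
      exacts [h2 k (by omega), h2 (k + 1) (by omega), h1 (k + 1) (by omega)]
  · intro t ht
    cases ht with
    | below ht => exact exists_MnmTri_of_belowTri (by omega) hβ ht
    | cap k hk =>
      refine ⟨_, mem_MnmTri_iff.2 (Or.inr (Or.inr ⟨k, hk, rfl⟩)), ?_⟩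
      rw [image_insert, image_insert, image_singleton, hα, hα]
      rfl
    | down k hk =>
      refine ⟨_, mem_MnmTri_iff.2 (Or.inl ⟨k, p, hk, by omega, Or.inr rfl⟩), ?_⟩
      rw [image_insert, image_insert, image_singleton, hα, hα, hβ]
    | up k hk =>
      refine ⟨_, mem_MnmTri_iff.2 (Or.inl ⟨k, p, hk, by omega, Or.inl rfl⟩), ?_⟩
      rw [image_insert, image_insert, image_singleton, hα, hβ, hβ]
  · intro s hs
    rcases mem_MnmTri_iff.1 hs with ⟨k, j, hk, hj, hs⟩ | ⟨k, hk, rfl⟩ | ⟨k, hk, rfl⟩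
    · by_cases hjp : j = p
      · subst hjp
        rcases hs with rfl | rfl
        · refine ⟨_, InitialTri.up k hk, ?_⟩
          rw [image_insert, image_insert, image_singleton, hα, hβ, hβ]
        · refine ⟨_, InitialTri.down k hk, ?_⟩
          rw [image_insert, image_insert, image_singleton, hα, hα, hβ]
      · obtain ⟨t, ht, hst⟩ := exists_belowTri_of_grid hβ hk (by omega : j < p) hs
        exact ⟨t, .below ht, hst⟩
    · obtain ⟨t, ht, hst⟩ := exists_belowTri_of_cap hβ hk
      exact ⟨t, .below ht, hst⟩
    · refine ⟨_, InitialTri.cap k hk, ?_⟩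
      rw [image_insert, image_insert, image_singleton, hα, hα]
      rfl

theorem iso_finalTri [NeZero n] :
    Iso (generated {t | FinalTri n (belowRim n p) (belowRows n p) t}) (Mnm n p) := by
  have hβ : ∀ k, position n p p (renewed n k) = gridVertex n p k p := position_renewed
  have hrenewed : ∀ k, k ≤ n → renewed n (k : ZMod n).val =
      (renewed n k : RimVertex (Option (ZMod n × ℕ))) := fun k hk => by
    have h : wrap n (wrap n k) = wrap n k := by grind [wrap, NeZero.ne n]
    rw [val_cast_eq_wrap hk, renewed, renewed, h]
  refine iso_generated (T := MnmTri n p) (position n p p) (vertexAt n p p (renewed n)) ?_ ?_ ?_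
  · have h1 : ∀ k ≤ n, vertexAt n p p (renewed n) (position n p p (renewed n k)) = renewed n k := by
      intro k hk
      rw [hβ, vertexAt_gridVertex le_rfl, if_neg (by omega), if_pos rfl, hrenewed k hk]
    intro t ht v hv
    cases ht with
    | below ht => exact vertexAt_position_of_belowTri le_rfl hβ hrenewed ht v hv
    | cap k hk =>
      simp only [mem_insert, mem_singleton] at hv
      rcases hv with rfl | rfl | rfl
      exacts [rfl, h1 k (by omega), h1 (k + 1) (by omega)]
  · intro t ht
    cases ht with
    | below ht => exact exists_MnmTri_of_belowTri le_rfl hβ ht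
    | cap k hk =>
      refine ⟨_, mem_MnmTri_iff.2 (Or.inr (Or.inr ⟨k, hk, rfl⟩)), ?_⟩
      rw [image_insert, image_insert, image_singleton, hβ, hβ]
      rfl
  · intro s hs
    rcases mem_MnmTri_iff.1 hs with ⟨k, j, hk, hj, hs⟩ | ⟨k, hk, rfl⟩ | ⟨k, hk, rfl⟩
    · obtain ⟨t, ht, hst⟩ := exists_belowTri_of_grid hβ hk hj hs
      exact ⟨t, .below ht, hst⟩
    · obtain ⟨t, ht, hst⟩ := exists_belowTri_of_cap hβ hk
      exact ⟨t, .below ht, hst⟩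
    · refine ⟨_, FinalTri.cap k hk, ?_⟩
      rw [image_insert, image_insert, image_singleton, hβ, hβ]
      rfl

end Grid

end SComplex

/-- For `n ≥ 3` and `m ≥ 1`, the triangulation `M_{n,m}` of `S²`
`8`-stars to `M_{n,m-1}`: some complex isomorphic to `M_{n,m}` is transformed by a
finite sequence of `8`-starrings into a complex isomorphic to `M_{n,m-1}`. -/
theorem Mnm_starsTo (n m : ℕ) (hn : 3 ≤ n) (hm : 1 ≤ m) :
    ∃ (A : Type) (X Y : SComplex A),
      SComplex.Iso X (Mnm n m) ∧
      SComplex.StarsTo 8 X Y ∧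
      SComplex.Iso Y (Mnm n (m - 1)) := by
  obtain ⟨p, rfl⟩ : ∃ p, m = p + 1 := ⟨m - 1, by omega⟩
  have : NeZero n := ⟨by omega⟩
  exact ⟨_, _, _, SComplex.iso_initialTri,
    SComplex.RimVertex.starsTo_finalTri hn (by simp [SComplex.belowRim]), SComplex.iso_finalTri⟩
end

section
/- For every integer n ≥ 4, the triangulation M_{n,0} of the 2-sphere (the simplicial suspension of a cycle on n vertices) 6-stars to M_{n−1,0}: replacing the star cluster of an edge of the cycle (a triangulated disk with 6 vertices) by the cone over its boundary yields a triangulation of S^2 isomorphic to M_{n−1,0}. -/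
open Finset
open scoped Classical

namespace SComplex

/-- The suspension, with apexes `inl false` and `inl true`, of the graph on `ℕ` with edge
relation `E`; a loop `E x x` contributes the isolated vertex `x`. -/
def suspension (E : ℕ → ℕ → Prop) : SComplex (Bool ⊕ ℕ) where
  faces := {σ | σ.Nonempty ∧ ∃ b x y, E x y ∧ σ ⊆ {Sum.inl b, Sum.inr x, Sum.inr y}}
  not_empty_mem := fun h => Finset.not_nonempty_empty h.1
  down_closed := by
    rintro s t ⟨-, b, x, y, hE, hs⟩ hts ht
    exact ⟨ht, b, x, y, hE, hts.trans hs⟩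

theorem mem_suspension {E : ℕ → ℕ → Prop} {σ : Finset (Bool ⊕ ℕ)} :
    σ ∈ (suspension E).faces ↔
      σ.Nonempty ∧ ∃ b x y, E x y ∧ σ ⊆ {Sum.inl b, Sum.inr x, Sum.inr y} :=
  Iff.rfl

theorem suspension_mono {E F : ℕ → ℕ → Prop} (h : ∀ x y, E x y → F x y) :
    (suspension E).faces ⊆ (suspension F).faces := by
  rintro σ ⟨hσ, b, x, y, hE, hs⟩
  exact ⟨hσ, b, x, y, h x y hE, hs⟩

theorem mem_realization_suspension {E : ℕ → ℕ → Prop} {p : Bool ⊕ ℕ → ℝ} :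
    p ∈ (suspension E).realization ↔ ∃ b x y, E x y ∧ (∀ v, 0 ≤ p v) ∧
      (∀ v, v ∉ ({Sum.inl b, Sum.inr x, Sum.inr y} : Finset (Bool ⊕ ℕ)) → p v = 0) ∧
      ∑ v ∈ ({Sum.inl b, Sum.inr x, Sum.inr y} : Finset (Bool ⊕ ℕ)), p v = 1 := by
  constructor
  · rintro ⟨σ, ⟨-, b, x, y, hE, hs⟩, h0, hz, hsum⟩
    refine ⟨b, x, y, hE, h0, fun v hv => hz v fun h => hv (hs h), ?_⟩
    rw [← hsum]
    exact (Finset.sum_subset hs fun v _ hv => hz v hv).symm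
  · rintro ⟨b, x, y, hE, h⟩
    exact ⟨_, ⟨⟨Sum.inl b, by simp⟩, b, x, y, hE, subset_rfl⟩, h⟩

/-- The map sending the cycle vertices of `M_{n,0}` along `φ` and fixing the two apexes. -/
def relabel {n : ℕ} (φ : ZMod n → ℕ) : Bool ⊕ ZMod n × Fin 1 → Bool ⊕ ℕ :=
  Sum.map id fun p => φ p.1

theorem relabel_injective {n : ℕ} {φ : ZMod n → ℕ} (hφ : Function.Injective φ) :
    Function.Injective (relabel φ) := by
  refine Function.injective_id.sumMap ?_
  rintro ⟨i, a⟩ ⟨j, b⟩ h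
  exact Prod.ext (hφ h) (Subsingleton.elim _ _)

theorem isIsoMap_relabel {n : ℕ} {φ : ZMod n → ℕ} {E : ℕ → ℕ → Prop}
    (hφ : Function.Injective φ) (hE : ∀ x y, E x y ↔ ∃ i, φ i = x ∧ φ (i + 1) = y) :
    IsIsoMap (relabel φ) (Mnm n 0) (suspension E) := by
  have image_tri (b : Bool) (i : ZMod n) :
      (({Sum.inl b, Sum.inr (i, 0), Sum.inr (i + 1, 0)} :
        Finset (Bool ⊕ ZMod n × Fin 1))).image (relabel φ) =
      {Sum.inl b, Sum.inr (φ i), Sum.inr (φ (i + 1))} := by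
    simp [Finset.image_insert, relabel]
  refine ⟨(relabel_injective hφ).injOn, ?_, ?_⟩
  · rintro σ ⟨hσ, T, hT, hs⟩
    have key : ∃ b i, T = {Sum.inl b, Sum.inr (i, 0), Sum.inr (i + 1, 0)} := by
      rcases hT with ⟨_, _, hj, _⟩ | ⟨i, rfl⟩ | ⟨i, rfl⟩
      · exact absurd hj (Nat.not_lt_zero _)
      · exact ⟨false, i, rfl⟩
      · exact ⟨true, i, rfl⟩
    obtain ⟨b, i, rfl⟩ := key
    have hmem : σ.image (relabel φ) ∈ (suspension E).faces := by
      refine ⟨hσ.image _, b, φ i, φ (i + 1), (hE _ _).2 ⟨i, rfl, rfl⟩, ?_⟩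
      rw [← image_tri]
      exact Finset.image_subset_image hs
    convert hmem
  · rintro τ ⟨hτ, b, x, y, hxy, hs⟩
    obtain ⟨i, rfl, rfl⟩ := (hE x y).1 hxy
    rw [← image_tri, Finset.subset_image_iff] at hs
    obtain ⟨σ, hσ, rfl⟩ := hs
    refine ⟨σ, ⟨hτ.of_image, _, ?_, hσ⟩, by convert rfl⟩
    cases b
    · exact Or.inr (Or.inl ⟨i, rfl⟩)
    · exact Or.inr (Or.inr ⟨i, rfl⟩)

/-- The edges of the cycle on `0, …, k + 3`. -/
def cycleEdge (k x y : ℕ) : Prop := (x + 1 = y ∧ x < k + 3) ∨ (x = k + 3 ∧ y = 0)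

/-- The edges of the path `k + 1, k + 2, k + 3, 0`. -/
def pathEdge (k x y : ℕ) : Prop :=
  (x = k + 1 ∧ y = k + 2) ∨ (x = k + 2 ∧ y = k + 3) ∨ (x = k + 3 ∧ y = 0)

/-- The loops at the endpoints `k + 1` and `0` of the path. -/
def pathEnds (k x y : ℕ) : Prop := x = y ∧ (x = k + 1 ∨ x = 0)

/-- The edges of the cycle on `0, …, k + 1, k + 4`. -/
def shortCycleEdge (k x y : ℕ) : Prop :=
  (x + 1 = y ∧ x < k + 1) ∨ (x = k + 1 ∧ y = k + 4) ∨ (x = k + 4 ∧ y = 0)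

theorem isIsoMap_cycle (k : ℕ) :
    IsIsoMap (relabel ZMod.val) (Mnm (k + 4) 0) (suspension (cycleEdge k)) := by
  refine isIsoMap_relabel (ZMod.val_injective _) fun x y => ?_
  have hadd (i : ZMod (k + 4)) : (i + 1).val = (i.val + 1) % (k + 4) := by
    rw [ZMod.val_add, ZMod.val_one'' (by omega)]
  constructor
  · rintro (⟨rfl, h⟩ | ⟨rfl, rfl⟩)
    · refine ⟨(x : ZMod (k + 4)), ZMod.val_natCast_of_lt (by omega), ?_⟩
      rw [hadd, ZMod.val_natCast_of_lt (by omega), Nat.mod_eq_of_lt (by omega)]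
    · refine ⟨((k + 3 : ℕ) : ZMod (k + 4)), ZMod.val_natCast_of_lt (by omega), ?_⟩
      rw [hadd, ZMod.val_natCast_of_lt (by omega), Nat.mod_self]
  · rintro ⟨i, rfl, rfl⟩
    have hi := i.val_lt
    rw [hadd]
    rcases Nat.lt_or_ge i.val (k + 3) with h | h
    · exact Or.inl ⟨(Nat.mod_eq_of_lt (by omega)).symm, h⟩
    · have : i.val = k + 3 := by omega
      exact Or.inr ⟨this, by rw [this, Nat.mod_self]⟩

/-- The labelling of the short cycle: the last vertex is the new one, `k + 4`. -/
def shortLabel (k : ℕ) (i : ZMod (k + 3)) : ℕ := if i.val < k + 2 then i.val else k + 4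

theorem isIsoMap_shortCycle (k : ℕ) :
    IsIsoMap (relabel (shortLabel k)) (Mnm (k + 3) 0) (suspension (shortCycleEdge k)) := by
  have hadd (i : ZMod (k + 3)) : (i + 1).val = (i.val + 1) % (k + 3) := by
    rw [ZMod.val_add, ZMod.val_one'' (by omega)]
  refine isIsoMap_relabel (fun i j hij => ZMod.val_injective _ ?_) fun x y => ?_
  · have hi := i.val_lt
    have hj := j.val_lt
    unfold shortLabel at hij
    split_ifs at hij <;> omega
  constructor
  · have hcast (m : ℕ) (hm : m < k + 3) : ((m : ℕ) : ZMod (k + 3)).val = m :=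
      ZMod.val_natCast_of_lt hm
    have hlabel (m : ℕ) (hm : m < k + 3) (hx : x = if m < k + 2 then m else k + 4)
        (hy : y = if (m + 1) % (k + 3) < k + 2 then (m + 1) % (k + 3) else k + 4) :
        ∃ i, shortLabel k i = x ∧ shortLabel k (i + 1) = y :=
      ⟨m, by rw [shortLabel, hcast m hm, hx], by rw [shortLabel, hadd, hcast m hm, hy]⟩
    rintro (⟨rfl, h⟩ | ⟨rfl, rfl⟩ | ⟨rfl, rfl⟩)
    · refine hlabel x (by omega) (by rw [if_pos (by omega)]) ?_
      rw [Nat.mod_eq_of_lt (by omega), if_pos (by omega)]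
    · refine hlabel (k + 1) (by omega) (by rw [if_pos (by omega)]) ?_
      rw [Nat.mod_eq_of_lt (by omega), if_neg (by omega)]
    · refine hlabel (k + 2) (by omega) (by rw [if_neg (by omega)]) ?_
      rw [Nat.mod_self, if_pos (by omega)]
  · rintro ⟨i, rfl, rfl⟩
    have hi := i.val_lt
    unfold shortLabel shortCycleEdge
    rw [hadd]
    rcases Nat.lt_or_ge i.val (k + 2) with h | h
    · rw [Nat.mod_eq_of_lt (by omega)]
      split_ifs <;> omega
    · have : i.val = k + 2 := by omega
      rw [this, Nat.mod_self]
      simp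

theorem subset_triple_iff {σ : Finset (Bool ⊕ ℕ)} {b : Bool} {x y : ℕ} :
    σ ⊆ {Sum.inl b, Sum.inr x, Sum.inr y} ↔
      (∀ c, Sum.inl c ∈ σ → c = b) ∧ ∀ z, Sum.inr z ∈ σ → z = x ∨ z = y := by
  constructor
  · intro h
    exact ⟨fun c hc => by simpa using h hc, fun z hz => by simpa using h hz⟩
  · rintro ⟨h₁, h₂⟩ (c | z) hv
    · simp [h₁ c hv]
    · rcases h₂ z hv with rfl | rfl <;> simp

theorem cycleEdge_iff {k x y : ℕ} :
    cycleEdge k x y ↔ (x + 1 = y ∧ x < k + 1) ∨ pathEdge k x y := by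
  unfold cycleEdge pathEdge
  omega

theorem mem_suspension_pathEnds {k : ℕ} {τ σ : Finset (Bool ⊕ ℕ)} {b : Bool} {x : ℕ}
    (hx : x < k + 1) (hσ : σ ⊆ {Sum.inl b, Sum.inr x, Sum.inr (x + 1)}) (hτσ : τ ⊆ σ)
    (hτ : τ ∈ (suspension (pathEdge k)).faces) : τ ∈ (suspension (pathEnds k)).faces := by
  obtain ⟨hne, c, p, q, hpq, hs⟩ := hτ
  have hb := subset_triple_iff.1 (hτσ.trans hσ)
  rw [subset_triple_iff] at hs
  by_cases h0 : Sum.inr 0 ∈ τ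
  · refine ⟨hne, c, 0, 0, ⟨rfl, Or.inr rfl⟩, subset_triple_iff.2 ⟨hs.1, fun z hz => ?_⟩⟩
    have h1 := hs.2 z hz
    have h2 := hb.2 z hz
    have h3 := hs.2 0 h0
    unfold pathEdge at hpq
    omega
  · refine ⟨hne, c, k + 1, k + 1, ⟨rfl, Or.inl rfl⟩,
      subset_triple_iff.2 ⟨hs.1, fun z hz => ?_⟩⟩
    have h1 := hs.2 z hz
    have h2 := hb.2 z hz
    have h3 : z ≠ 0 := fun h => h0 (h ▸ hz)
    unfold pathEdge at hpq
    omega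

theorem suspension_pathEnds_subset (k : ℕ) :
    (suspension (pathEnds k)).faces ⊆ (suspension (pathEdge k)).faces := by
  rintro σ ⟨hne, b, x, y, ⟨rfl, rfl | rfl⟩, hs⟩
  · refine ⟨hne, b, k + 1, k + 2, by simp [pathEdge], hs.trans ?_⟩
    intro; simp; tauto
  · refine ⟨hne, b, k + 3, 0, by simp [pathEdge], hs.trans ?_⟩
    intro; simp; tauto

theorem suspension_pathEdge_eq_star (k : ℕ) :
    (suspension (pathEdge k)).faces = {τ ∈ (suspension (cycleEdge k)).faces |
      insert (Sum.inr (k + 2)) τ ∈ (suspension (cycleEdge k)).faces ∨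
      insert (Sum.inr (k + 3)) τ ∈ (suspension (cycleEdge k)).faces} := by
  ext τ
  constructor
  · intro h
    refine ⟨suspension_mono (fun x y h => cycleEdge_iff.2 (Or.inr h)) h, ?_⟩
    obtain ⟨hne, b, x, y, hE, hs⟩ := h
    have hE' : cycleEdge k x y := cycleEdge_iff.2 (Or.inr hE)
    have : (x = k + 2 ∨ y = k + 2) ∨ (x = k + 3 ∨ y = k + 3) := by
      unfold pathEdge at hE
      omega
    refine this.imp ?_ ?_ <;>
    · intro h
      refine ⟨Finset.insert_nonempty _ _, b, x, y, hE', Finset.insert_subset ?_ hs⟩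
      rcases h with h | h <;> simp [h]
  · rintro ⟨⟨hne, -⟩, h⟩
    have key (v : ℕ) (hv : v = k + 2 ∨ v = k + 3)
        (h : insert (Sum.inr v) τ ∈ (suspension (cycleEdge k)).faces) :
        τ ∈ (suspension (pathEdge k)).faces := by
      obtain ⟨-, b, x, y, hE, hs⟩ := h
      refine ⟨hne, b, x, y, ?_, (Finset.subset_insert _ _).trans hs⟩
      have := (subset_triple_iff.1 hs).2 v (Finset.mem_insert_self _ _)
      unfold cycleEdge at hE
      unfold pathEdge
      omega
    exact h.elim (key _ (Or.inl rfl)) (key _ (Or.inr rfl))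

theorem suspension_shortCycleEdge_eq (k : ℕ) :
    (suspension (shortCycleEdge k)).faces =
      ((suspension (cycleEdge k)).faces \
        {τ | τ ∈ (suspension (pathEdge k)).faces ∧ τ ∉ (suspension (pathEnds k)).faces}) ∪
      coneFaces (Sum.inr (k + 4)) (suspension (pathEnds k)).faces := by
  have pathEnds_subset {b : Bool} {x : ℕ} (hx : x = k + 1 ∨ x = 0) :
      ∃ p q, shortCycleEdge k p q ∧
        ({Sum.inr (k + 4), Sum.inl b, Sum.inr x, Sum.inr x} : Finset (Bool ⊕ ℕ)) ⊆
          {Sum.inl b, Sum.inr p, Sum.inr q} := by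
    rcases hx with rfl | rfl
    · exact ⟨k + 1, k + 4, by simp [shortCycleEdge], by intro; simp; tauto⟩
    · exact ⟨k + 4, 0, by simp [shortCycleEdge], by intro; simp; tauto⟩
  ext τ
  constructor
  · rintro ⟨hne, b, x, y, hE, hs⟩
    rcases hE with ⟨rfl, hx⟩ | hE
    · exact Or.inl ⟨⟨hne, b, x, x + 1, cycleEdge_iff.2 (Or.inl ⟨rfl, hx⟩), hs⟩,
        fun h => h.2 (mem_suspension_pathEnds hx hs subset_rfl h.1)⟩
    · right
      have key {ρ : Finset (Bool ⊕ ℕ)} (hρ : ρ.Nonempty) (hρτ : ρ ⊆ τ)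
          (hw : Sum.inr (k + 4) ∉ ρ) : ρ ∈ (suspension (pathEnds k)).faces := by
        have hs' := subset_triple_iff.1 (hρτ.trans hs)
        rcases hE with ⟨rfl, rfl⟩ | ⟨rfl, rfl⟩
        · refine ⟨hρ, b, k + 1, k + 1, ⟨rfl, Or.inl rfl⟩, subset_triple_iff.2
            ⟨hs'.1, fun z hz => ?_⟩⟩
          rcases hs'.2 z hz with rfl | rfl
          · exact Or.inl rfl
          · exact absurd hz hw
        · refine ⟨hρ, b, 0, 0, ⟨rfl, Or.inr rfl⟩, subset_triple_iff.2
            ⟨hs'.1, fun z hz => ?_⟩⟩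
          rcases hs'.2 z hz with rfl | rfl
          · exact absurd hz hw
          · exact Or.inl rfl
      by_cases hw : Sum.inr (k + 4) ∈ τ
      · rcases (τ.erase (Sum.inr (k + 4))).eq_empty_or_nonempty with h | h
        · right
          rw [Set.mem_singleton_iff, ← Finset.insert_erase hw, h]
          rfl
        · exact Or.inl (Or.inr ⟨_, key h (Finset.erase_subset _ _)
            (Finset.notMem_erase _ _), by convert Finset.insert_erase hw⟩)
      · exact Or.inl (Or.inl (key hne subset_rfl hw))
  · have mem_of_pathEnds {τ} (h : τ ∈ (suspension (pathEnds k)).faces) :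
        insert (Sum.inr (k + 4)) τ ∈ (suspension (shortCycleEdge k)).faces := by
      obtain ⟨-, b, x, y, ⟨rfl, hx⟩, hs⟩ := h
      obtain ⟨p, q, hpq, hsub⟩ := pathEnds_subset (b := b) hx
      exact ⟨Finset.insert_nonempty _ _, b, p, q, hpq,
        (Finset.insert_subset_insert _ hs).trans hsub⟩
    have mem_of_pathEnds' {τ} (h : τ ∈ (suspension (pathEnds k)).faces) :
        τ ∈ (suspension (shortCycleEdge k)).faces :=
      (suspension _).down_closed (mem_of_pathEnds h) (Finset.subset_insert _ _) h.1
    rintro (⟨⟨hne, b, x, y, hE, hs⟩, h⟩ | (h | ⟨ρ, hρ, rfl⟩) | rfl)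
    · rcases cycleEdge_iff.1 hE with hE | hE
      · exact ⟨hne, b, x, y, Or.inl hE, hs⟩
      · refine mem_of_pathEnds' (by_contra fun hτ => h ⟨⟨hne, b, x, y, hE, hs⟩, hτ⟩)
    · exact mem_of_pathEnds' h
    · convert mem_of_pathEnds hρ
    · exact ⟨Finset.singleton_nonempty _, true, k + 1, k + 4, by simp [shortCycleEdge],
        by simp⟩

theorem vertexSet_suspension_pathEdge (k : ℕ) :
    (suspension (pathEdge k)).vertexSet =
      (({Sum.inl true, Sum.inl false, Sum.inr 0, Sum.inr (k + 1), Sum.inr (k + 2),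
        Sum.inr (k + 3)} : Finset (Bool ⊕ ℕ)) : Set (Bool ⊕ ℕ)) := by
  ext v
  simp only [vertexSet, Set.mem_ofPred_eq, mem_suspension, Finset.singleton_nonempty,
    true_and, Finset.singleton_subset_iff]
  constructor
  · rintro ⟨b, x, y, hE, hv⟩
    unfold pathEdge at hE
    cases b <;> simp at hv ⊢ <;> grind
  · intro hv
    simp only [Finset.coe_insert, Finset.coe_singleton, Set.mem_insert_iff,
      Set.mem_singleton_iff] at hv
    rcases hv with rfl | rfl | rfl | rfl | rfl | rfl
    · exact ⟨true, k + 3, 0, by simp [pathEdge], by simp⟩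
    · exact ⟨false, k + 3, 0, by simp [pathEdge], by simp⟩
    · exact ⟨true, k + 3, 0, by simp [pathEdge], by simp⟩
    · exact ⟨true, k + 1, k + 2, by simp [pathEdge], by simp⟩
    · exact ⟨true, k + 1, k + 2, by simp [pathEdge], by simp⟩
    · exact ⟨true, k + 3, 0, by simp [pathEdge], by simp⟩

theorem ncard_vertexSet_suspension_pathEdge (k : ℕ) :
    (suspension (pathEdge k)).vertexSet.ncard = 6 := by
  rw [vertexSet_suspension_pathEdge, Set.ncard_coe_finset]
  simp [Finset.card_insert_of_notMem]

/-- The closed unit ball of the `ℓ¹` norm in the plane. -/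
def diamond : Set (EuclideanSpace ℝ (Fin 2)) := {z | |z 0| + |z 1| ≤ 1}

theorem mem_diamond {z : EuclideanSpace ℝ (Fin 2)} :
    z ∈ diamond ↔ abs (α := ℝ) (z 0) + abs (α := ℝ) (z 1) ≤ (1 : ℝ) :=
  Iff.rfl

theorem continuous_abs_add_abs :
    Continuous fun z : EuclideanSpace ℝ (Fin 2) => |z 0| + |z 1| := by
  fun_prop

theorem isClosed_diamond : IsClosed diamond :=
  isClosed_le continuous_abs_add_abs continuous_const

theorem interior_diamond : interior diamond = {z | |z 0| + |z 1| < 1} := by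
  apply subset_antisymm
  · intro z hz
    have hz1 := mem_diamond.1 (interior_subset hz)
    refine lt_of_le_of_ne hz1 fun h => ?_
    have hc : Filter.Tendsto (fun t : ℝ => t • z) (nhds 1) (nhds z) := by
      have : Continuous fun t : ℝ => t • z := by fun_prop
      simpa using this.tendsto 1
    have hev : ∀ᶠ t in nhds (1 : ℝ), t • z ∈ diamond :=
      hc.eventually (mem_interior_iff_mem_nhds.1 hz)
    obtain ⟨ε, hε, hball⟩ := Metric.eventually_nhds_iff.1 hev
    have hmem : |(1 + ε / 2) * z 0| + |(1 + ε / 2) * z 1| ≤ 1 := by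
      refine hball (y := 1 + ε / 2) ?_
      rw [Real.dist_eq, add_sub_cancel_left, abs_of_pos (by positivity)]
      linarith
    rw [abs_mul, abs_mul, ← mul_add, h, abs_of_pos (by positivity)] at hmem
    linarith
  · exact interior_maximal (fun z hz => mem_diamond.2 (le_of_lt hz))
      (isOpen_lt continuous_abs_add_abs continuous_const)

theorem convex_diamond : Convex ℝ diamond := by
  intro x hx y hy a b ha hb hab
  simp only [diamond, Set.mem_ofPred_eq, PiLp.add_apply, PiLp.smul_apply, smul_eq_mul] at *
  have h0 := abs_add_le (a * x 0) (b * y 0)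
  have h1 := abs_add_le (a * x 1) (b * y 1)
  rw [abs_mul, abs_mul, abs_of_nonneg ha, abs_of_nonneg hb] at h0 h1
  nlinarith

theorem isBounded_diamond : Bornology.IsBounded diamond := by
  refine (Metric.isBounded_closedBall (x := (0 : EuclideanSpace ℝ (Fin 2)))
    (r := 1)).subset fun z hz => ?_
  have hz' := mem_diamond.1 hz
  rw [mem_closedBall_zero_iff, EuclideanSpace.norm_eq, Real.sqrt_le_one,
    Fin.sum_univ_two, Real.norm_eq_abs, Real.norm_eq_abs]
  nlinarith [abs_nonneg (z 0), abs_nonneg (z 1)]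

theorem exists_homeomorph_diamond_closedBall :
    ∃ e : diamond ≃ₜ Metric.closedBall (0 : EuclideanSpace ℝ (Fin 2)) 1,
      ∀ z : diamond, |z.1 0| + |z.1 1| = 1 ↔
        (e z : EuclideanSpace ℝ (Fin 2)) ∈ Metric.sphere (0 : EuclideanSpace ℝ (Fin 2)) 1 := by
  obtain ⟨h, -, hcl, hfr⟩ := exists_homeomorph_image_interior_closure_frontier_eq_unitBall
    convex_diamond ⟨0, by rw [interior_diamond]; simp⟩ isBounded_diamond
  rw [isClosed_diamond.closure_eq] at hcl
  refine ⟨h.subtype fun z => ?_, fun z => ?_⟩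
  · rw [← hcl, h.injective.mem_set_image]
  · have hz : |z.1 0| + |z.1 1| ≤ 1 := z.2
    change _ ↔ h z.1 ∈ _
    rw [← hfr, h.injective.mem_set_image, frontier, isClosed_diamond.closure_eq,
      interior_diamond]
    simp only [Set.mem_sdiff, z.2, true_and, Set.mem_ofPred_eq, not_lt]
    exact ⟨fun h => h.ge, fun h => le_antisymm hz h⟩

theorem exists_apex_of_eq_zero {p : Bool ⊕ ℕ → ℝ}
    (hp : p (Sum.inl true) = 0 ∨ p (Sum.inl false) = 0) :
    ∃ b, p (Sum.inl (!b)) = 0 ∧ p (Sum.inl true) + p (Sum.inl false) = p (Sum.inl b) := by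
  rcases hp with h | h
  · exact ⟨false, h, by simp [h]⟩
  · exact ⟨true, h, by simp [h]⟩

/-- Points of the suspended path in coordinates: heights, and barycentric coordinates along
the path. -/
theorem mem_realization_pathEdge {k : ℕ} {p : Bool ⊕ ℕ → ℝ} :
    p ∈ (suspension (pathEdge k)).realization ↔
      (∀ v, 0 ≤ p v) ∧
      (∀ m, m ≠ 0 → m ≠ k + 1 → m ≠ k + 2 → m ≠ k + 3 → p (Sum.inr m) = 0) ∧
      (p (Sum.inl true) = 0 ∨ p (Sum.inl false) = 0) ∧
      ((p (Sum.inr (k + 3)) = 0 ∧ p (Sum.inr 0) = 0) ∨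
        (p (Sum.inr (k + 1)) = 0 ∧ p (Sum.inr 0) = 0) ∨
        (p (Sum.inr (k + 1)) = 0 ∧ p (Sum.inr (k + 2)) = 0)) ∧
      p (Sum.inl true) + p (Sum.inl false) + p (Sum.inr (k + 1)) + p (Sum.inr (k + 2)) +
        p (Sum.inr (k + 3)) + p (Sum.inr 0) = 1 := by
  rw [mem_realization_suspension]
  constructor
  · rintro ⟨b, x, y, hE, h0, hz, hsum⟩
    have hbz : p (Sum.inl (!b)) = 0 := hz _ (by simp)
    have hxz (m : ℕ) (h₁ : m ≠ x) (h₂ : m ≠ y) : p (Sum.inr m) = 0 := hz _ (by simp [h₁, h₂])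
    have hne : x ≠ y := by
      unfold pathEdge at hE
      omega
    rw [Finset.sum_insert (by simp), Finset.sum_pair (by simpa using hne)] at hsum
    have hb : p (Sum.inl true) + p (Sum.inl false) = p (Sum.inl b) ∧
        (p (Sum.inl true) = 0 ∨ p (Sum.inl false) = 0) := by
      cases b <;> simp_all
    refine ⟨h0, fun m h₁ h₂ h₃ h₄ => hxz m ?_ ?_, hb.2, ?_⟩
    · unfold pathEdge at hE
      omega
    · unfold pathEdge at hE
      omega
    · rw [hb.1]
      rcases hE with ⟨rfl, rfl⟩ | ⟨rfl, rfl⟩ | ⟨rfl, rfl⟩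
      · have h₃ := hxz (k + 3) (by omega) (by omega)
        have h₄ := hxz 0 (by omega) (by omega)
        exact ⟨Or.inl ⟨h₃, h₄⟩, by linarith⟩
      · have h₁ := hxz (k + 1) (by omega) (by omega)
        have h₄ := hxz 0 (by omega) (by omega)
        exact ⟨Or.inr (Or.inl ⟨h₁, h₄⟩), by linarith⟩
      · have h₁ := hxz (k + 1) (by omega) (by omega)
        have h₂ := hxz (k + 2) (by omega) (by omega)
        exact ⟨Or.inr (Or.inr ⟨h₁, h₂⟩), by linarith⟩
  · rintro ⟨h0, hz, hb, hpath, hsum⟩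
    obtain ⟨b, hb, hbsum⟩ := exists_apex_of_eq_zero hb
    rw [hbsum] at hsum
    obtain ⟨x, y, hE, hxz, hxysum⟩ : ∃ x y, pathEdge k x y ∧
        (∀ m, m ≠ x → m ≠ y → p (Sum.inr m) = 0) ∧
        p (Sum.inl b) + (p (Sum.inr x) + p (Sum.inr y)) = 1 := by
      rcases hpath with ⟨h₁, h₂⟩ | ⟨h₁, h₂⟩ | ⟨h₁, h₂⟩
      · refine ⟨k + 1, k + 2, by simp [pathEdge], fun m _ _ => ?_, by linarith⟩
        by_cases m = k + 3 <;> by_cases m = 0 <;> simp_all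
      · refine ⟨k + 2, k + 3, by simp [pathEdge], fun m _ _ => ?_, by linarith⟩
        by_cases m = k + 1 <;> by_cases m = 0 <;> simp_all
      · refine ⟨k + 3, 0, by simp [pathEdge], fun m _ _ => ?_, by linarith⟩
        by_cases m = k + 1 <;> by_cases m = k + 2 <;> simp_all
    have hne : x ≠ y := by
      unfold pathEdge at hE
      omega
    refine ⟨b, x, y, hE, h0, ?_, ?_⟩
    · rintro (c | m) hv
      · have : c = !b := by simpa [Bool.eq_not] using hv
        rw [this, hb]
      · simp at hv
        exact hxz m hv.1 hv.2
    · rw [Finset.sum_insert (by simp), Finset.sum_pair (by simpa using hne), hxysum]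

theorem mem_realization_pathEnds_iff {k : ℕ} {p : Bool ⊕ ℕ → ℝ}
    (hp : p ∈ (suspension (pathEdge k)).realization) :
    p ∈ (suspension (pathEnds k)).realization ↔
      p (Sum.inr (k + 2)) = 0 ∧ p (Sum.inr (k + 3)) = 0 := by
  rw [mem_realization_suspension]
  constructor
  · rintro ⟨b, x, y, ⟨rfl, hx⟩, h0, hz, hsum⟩
    exact ⟨hz _ (by simp; omega), hz _ (by simp; omega)⟩
  · rintro ⟨h₂, h₃⟩
    obtain ⟨h0, hz, hb, hpath, hsum⟩ := mem_realization_pathEdge.1 hp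
    obtain ⟨b, hb, hbsum⟩ := exists_apex_of_eq_zero hb
    rw [hbsum] at hsum
    obtain ⟨x, hE, hxz, hxsum⟩ : ∃ x, (x = k + 1 ∨ x = 0) ∧
        (∀ m, m ≠ x → p (Sum.inr m) = 0) ∧ p (Sum.inl b) + p (Sum.inr x) = 1 := by
      have hends : p (Sum.inr (k + 1)) = 0 ∨ p (Sum.inr 0) = 0 := by tauto
      rcases hends with h | h
      · refine ⟨0, Or.inr rfl, fun m _ => ?_, by linarith⟩
        by_cases m = k + 1 <;> by_cases m = k + 2 <;> by_cases m = k + 3 <;> simp_all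
      · refine ⟨k + 1, Or.inl rfl, fun m _ => ?_, by linarith⟩
        by_cases m = 0 <;> by_cases m = k + 2 <;> by_cases m = k + 3 <;> simp_all
    refine ⟨b, x, x, ⟨rfl, hE⟩, h0, ?_, ?_⟩
    · rintro (c | m) hv
      · have : c = !b := by simpa [Bool.eq_not] using hv
        rw [this, hb]
      · simp at hv
        exact hxz m hv
    · rw [Finset.pair_eq_singleton, Finset.sum_pair (by simp), hxsum]

/-- The piecewise linear projection of the suspended path to the plane. -/
noncomputable def toPlane (k : ℕ) (p : Bool ⊕ ℕ → ℝ) : EuclideanSpace ℝ (Fin 2) :=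
  !₂[p (Sum.inr 0) - p (Sum.inr (k + 1)) + (p (Sum.inr (k + 3)) - p (Sum.inr (k + 2))) / 3,
    p (Sum.inl true) - p (Sum.inl false)]

/-- The inverse of `toPlane` on the diamond: hat functions at the four points
`-1, -1/3, 1/3, 1`, rescaled by the width `1 - |z 1|` of the diamond at height `z 1`. -/
noncomputable def ofPlane (k : ℕ) (z : EuclideanSpace ℝ (Fin 2)) : Bool ⊕ ℕ → ℝ
  | Sum.inl true => max (z 1) 0
  | Sum.inl false => max (-z 1) 0
  | Sum.inr m =>
    if m = 0 then max ((3 * z 0 - (1 - |z 1|)) / 2) 0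
    else if m = k + 1 then max ((-3 * z 0 - (1 - |z 1|)) / 2) 0
    else if m = k + 2 then
      max (min ((3 * z 0 + 3 * (1 - |z 1|)) / 2) (((1 - |z 1|) - 3 * z 0) / 2)) 0
    else if m = k + 3 then
      max (min ((3 * (1 - |z 1|) - 3 * z 0) / 2) (((1 - |z 1|) + 3 * z 0) / 2)) 0
    else 0

theorem continuous_toPlane (k : ℕ) : Continuous (toPlane k) := by
  unfold toPlane
  fun_prop

theorem continuous_ofPlane (k : ℕ) : Continuous (ofPlane k) := by
  refine continuous_pi ?_
  rintro ((_ | _) | m)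
  · simp only [ofPlane]
    fun_prop
  · simp only [ofPlane]
    fun_prop
  · simp only [ofPlane]
    split_ifs <;> fun_prop

theorem toPlane_mem_diamond {k : ℕ} {p : Bool ⊕ ℕ → ℝ}
    (hp : p ∈ (suspension (pathEdge k)).realization) : toPlane k p ∈ diamond := by
  obtain ⟨h0, -, -, -, hsum⟩ := mem_realization_pathEdge.1 hp
  have hN := h0 (Sum.inl true)
  have hS := h0 (Sum.inl false)
  have h₁ := h0 (Sum.inr (k + 1))
  have h₂ := h0 (Sum.inr (k + 2))
  have h₃ := h0 (Sum.inr (k + 3))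
  have h₄ := h0 (Sum.inr 0)
  simp only [mem_diamond, toPlane, Matrix.cons_val_zero, Matrix.cons_val_one]
  grind

theorem abs_add_abs_toPlane_eq_one_iff {k : ℕ} {p : Bool ⊕ ℕ → ℝ}
    (hp : p ∈ (suspension (pathEdge k)).realization) :
    |toPlane k p 0| + |toPlane k p 1| = 1 ↔
      p (Sum.inr (k + 2)) = 0 ∧ p (Sum.inr (k + 3)) = 0 := by
  obtain ⟨h0, -, hb, hpath, hsum⟩ := mem_realization_pathEdge.1 hp
  have hN := h0 (Sum.inl true)
  have hS := h0 (Sum.inl false)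
  have h₁ := h0 (Sum.inr (k + 1))
  have h₂ := h0 (Sum.inr (k + 2))
  have h₃ := h0 (Sum.inr (k + 3))
  have h₄ := h0 (Sum.inr 0)
  simp only [toPlane, PiLp.toLp_apply, Matrix.cons_val_zero, Matrix.cons_val_one]
  grind

theorem ofPlane_mem_realization {k : ℕ} {z : EuclideanSpace ℝ (Fin 2)} (hz : z ∈ diamond) :
    ofPlane k z ∈ (suspension (pathEdge k)).realization := by
  have hz' := mem_diamond.1 hz
  rw [mem_realization_pathEdge]
  refine ⟨?_, ?_, ?_, ?_, ?_⟩
  · rintro ((_ | _) | m) <;> simp only [ofPlane]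
    · positivity
    · positivity
    · split_ifs <;> positivity
  · intro m h₁ h₂ h₃ h₄
    simp [ofPlane, h₁, h₂, h₃, h₄]
  · simp only [ofPlane]
    grind
  · simp [ofPlane]
    grind
  · simp [ofPlane]
    grind

theorem toPlane_ofPlane {k : ℕ} {z : EuclideanSpace ℝ (Fin 2)} (hz : z ∈ diamond) :
    toPlane k (ofPlane k z) = z := by
  have hz' := mem_diamond.1 hz
  ext i
  fin_cases i
  · simp [toPlane, ofPlane]
    grind
  · simp [toPlane, ofPlane]

theorem ofPlane_toPlane {k : ℕ} {p : Bool ⊕ ℕ → ℝ}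
    (hp : p ∈ (suspension (pathEdge k)).realization) : ofPlane k (toPlane k p) = p := by
  obtain ⟨h0, hz, hb, hpath, hsum⟩ := mem_realization_pathEdge.1 hp
  have hN := h0 (Sum.inl true)
  have hS := h0 (Sum.inl false)
  have h₁ := h0 (Sum.inr (k + 1))
  have h₂ := h0 (Sum.inr (k + 2))
  have h₃ := h0 (Sum.inr (k + 3))
  have h₄ := h0 (Sum.inr 0)
  have habs : 1 - |p (Sum.inl true) - p (Sum.inl false)| = p (Sum.inr (k + 1)) +
      p (Sum.inr (k + 2)) + p (Sum.inr (k + 3)) + p (Sum.inr 0) := by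
    grind
  ext ((_ | _) | m)
  · simp [toPlane, ofPlane]
    grind
  · simp [toPlane, ofPlane]
    grind
  · simp only [toPlane, ofPlane, PiLp.toLp_apply, Matrix.cons_val_zero, Matrix.cons_val_one,
      habs]
    split_ifs with c₁ c₂ c₃ c₄
    · subst c₁; grind
    · subst c₂; grind
    · subst c₃; grind
    · subst c₄; grind
    · exact (hz m c₁ c₂ c₃ c₄).symm

/-- The suspended path is homeomorphic to the diamond. -/
noncomputable def suspensionPathHomeomorph (k : ℕ) :
    (suspension (pathEdge k)).space ≃ₜ diamond where
  toFun p := ⟨toPlane k p.1, toPlane_mem_diamond p.2⟩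
  invFun z := ⟨ofPlane k z.1, ofPlane_mem_realization z.2⟩
  left_inv p := Subtype.ext (ofPlane_toPlane p.2)
  right_inv z := Subtype.ext (toPlane_ofPlane z.2)
  continuous_toFun := ((continuous_toPlane k).comp continuous_subtype_val).subtype_mk _
  continuous_invFun := ((continuous_ofPlane k).comp continuous_subtype_val).subtype_mk _

theorem isTriangulatedDisk_suspension_path (k : ℕ) :
    IsTriangulatedDisk (suspension (pathEdge k)) (suspension (pathEnds k)) 2 := by
  refine ⟨suspension_pathEnds_subset k, ?_⟩
  obtain ⟨e, he⟩ := exists_homeomorph_diamond_closedBall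
  refine ⟨(suspensionPathHomeomorph k).trans e, fun p => ?_⟩
  rw [mem_realization_pathEnds_iff p.2, ← abs_add_abs_toPlane_eq_one_iff p.2]
  exact he (suspensionPathHomeomorph k p)

theorem isStarringAt_suspension (k : ℕ) :
    IsStarringAt 6 (suspension (cycleEdge k)) (suspension (shortCycleEdge k))
      (suspension (pathEdge k)) (suspension (pathEnds k)) 2 (Sum.inr (k + 4)) := by
  refine ⟨suspension_mono fun x y h => cycleEdge_iff.2 (Or.inr h), ?_, ?_,
    isTriangulatedDisk_suspension_path k, ?_, ?_, suspension_shortCycleEdge_eq k⟩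
  · rw [vertexSet_suspension_pathEdge]
    exact Finset.finite_toSet _
  · rw [ncard_vertexSet_suspension_pathEdge]
    rfl
  · rintro σ ⟨hne, b, x, y, hE, hs⟩ τ hτ hτ' hτσ
    rcases cycleEdge_iff.1 hE with ⟨rfl, hx⟩ | hE
    · exact absurd (mem_suspension_pathEnds hx hs hτσ hτ) hτ'
    · exact ⟨hne, b, x, y, hE, hs⟩
  · rintro ⟨-, b, x, y, hE, hs⟩
    have := (subset_triple_iff.1 hs).2 (k + 4) (Finset.mem_singleton_self _)
    unfold cycleEdge at hE
    omega

end SComplex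

/-- For `n ≥ 4`, the suspension `M_{n,0}` of the `n`-cycle `6`-stars
to `M_{n-1,0}` by a single `6`-starring: replacing the star cluster of an edge of the
cycle (a triangulated disk with `6` vertices) by the cone over its boundary yields a
triangulation of `S²` isomorphic to `M_{n-1,0}`. -/
theorem Mn0_starsTo (n : ℕ) (hn : 4 ≤ n) :
    ∃ (A : Type) (X Y : SComplex A)
      (f : (Bool ⊕ ZMod n × Fin 1) → A) (g : (Bool ⊕ ZMod (n - 1) × Fin 1) → A),
      SComplex.IsIsoMap f (Mnm n 0) X ∧
      SComplex.IsIsoMap g (Mnm (n - 1) 0) Y ∧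
      ∃ (i : ZMod n) (D bD : SComplex A) (w : A),
        ({f (Sum.inr (i, 0)), f (Sum.inr (i + 1, 0))} : Finset A) ∈ X.faces ∧
        D.faces = {τ ∈ X.faces |
          insert (f (Sum.inr (i, 0))) τ ∈ X.faces ∨
          insert (f (Sum.inr (i + 1, 0))) τ ∈ X.faces} ∧
        D.vertexSet.ncard = 6 ∧
        SComplex.IsStarringAt 6 X Y D bD 2 w := by
  obtain ⟨k, rfl⟩ := Nat.exists_eq_add_of_le' hn
  have h₂ : ((k + 2 : ℕ) : ZMod (k + 4)).val = k + 2 := ZMod.val_natCast_of_lt (by omega)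
  have h₃ : (((k + 2 : ℕ) : ZMod (k + 4)) + 1).val = k + 3 := by
    rw [← Nat.cast_succ]
    exact ZMod.val_natCast_of_lt (by omega)
  refine ⟨Bool ⊕ ℕ, SComplex.suspension (SComplex.cycleEdge k),
    SComplex.suspension (SComplex.shortCycleEdge k), SComplex.relabel ZMod.val,
    SComplex.relabel (SComplex.shortLabel k), SComplex.isIsoMap_cycle k,
    SComplex.isIsoMap_shortCycle k, (k + 2 : ℕ), SComplex.suspension (SComplex.pathEdge k),
    SComplex.suspension (SComplex.pathEnds k), Sum.inr (k + 4), ?_, ?_,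
    SComplex.ncard_vertexSet_suspension_pathEdge k, SComplex.isStarringAt_suspension k⟩
  · simp only [SComplex.relabel, Sum.map_inr, h₂, h₃]
    have hmem : ({Sum.inr (k + 2), Sum.inr (k + 3)} : Finset (Bool ⊕ ℕ)) ∈
        (SComplex.suspension (SComplex.cycleEdge k)).faces :=
      ⟨Finset.insert_nonempty _ _, true, k + 2, k + 3, by simp [SComplex.cycleEdge],
        Finset.subset_insert _ _⟩
    convert hmem
  · simp only [SComplex.relabel, Sum.map_inr, h₂, h₃]
    convert SComplex.suspension_pathEdge_eq_star k
end
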